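/- arXiv:1708.03037 — 9 statements merged into one kernel-verified Lean document; each statement's English description precedes it below -/
import Mathlib

section
/- If a multiplicative function f : ℕ → ℂ satisfies f(a+b) = f(a) + f(b) for all a, b in the set PRIMES−1 = { p − 1 : p prime }, then f is the identity function, i.e., f(n) = n for all positive integers n. Consequently, PRIMES−1 is an additive uniqueness set for the class of multiplicative functions. -/
theorem exists_coprime_part_factorial {D : ℕ} (hD : D ≠ 0) (n : ℕ) :
    ∃ u w : ℕ, n.factorial = u * w ∧ u.Coprime D ∧ 0 < u ∧ 0 < w ∧
      Real.log w ≤ n * (D.primeFactors.card : ℝ) := by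
  classical
  have hfac := Nat.prod_factorization_pow_eq_self (Nat.factorial_ne_zero n)
  rw [Finsupp.prod, Nat.support_factorization,
    ← Finset.prod_filter_not_mul_prod_filter _ (· ∈ D.primeFactors)] at hfac
  refine ⟨_, _, hfac.symm, ?_, ?_, ?_, ?_⟩
  · refine Nat.Coprime.prod_left fun l hl => ?_
    simp only [Finset.mem_filter, Nat.mem_primeFactors] at hl
    refine Nat.Coprime.pow_left _ ((Nat.Prime.coprime_iff_not_dvd hl.1.1).2 fun h => hl.2 ⟨hl.1.1, h, hD⟩)
  · exact Finset.prod_pos fun l hl => pow_pos (Nat.pos_of_mem_primeFactors (Finset.mem_filter.1 hl).1) _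
  · exact Finset.prod_pos fun l hl => pow_pos (Nat.pos_of_mem_primeFactors (Finset.mem_filter.1 hl).1) _
  · rw [Nat.cast_prod, Real.log_prod]
    · have key : ∀ l ∈ n.factorial.primeFactors.filter (· ∈ D.primeFactors),
          Real.log ((l ^ n.factorial.factorization l : ℕ) : ℝ) ≤ n := by
        intro l hl
        have hp : l.Prime := Nat.prime_of_mem_primeFactors (Finset.mem_filter.1 hl).1
        have := Fact.mk hp
        have h1 := sub_one_mul_padicValNat_factorial (p := l) n
        rw [Nat.factorization_def _ hp]
        have h2 : ((l : ℝ) - 1) * (padicValNat l n.factorial : ℝ) ≤ n := by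
          have : (l - 1) * padicValNat l n.factorial ≤ n := by omega
          have h3 : (((l - 1 : ℕ) : ℝ)) * (padicValNat l n.factorial : ℝ) ≤ n := by exact_mod_cast this
          rwa [Nat.cast_sub hp.one_lt.le, Nat.cast_one] at h3
        have h3 := Real.log_le_sub_one_of_pos (x := (l : ℝ)) (by exact_mod_cast hp.pos)
        push_cast
        rw [Real.log_pow]
        nlinarith [(Nat.cast_nonneg (padicValNat l n.factorial) : (0 : ℝ) ≤ _)]
      calc _ ≤ ∑ l ∈ n.factorial.primeFactors.filter (· ∈ D.primeFactors), (n : ℝ) :=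
            Finset.sum_le_sum key
        _ = ((n.factorial.primeFactors.filter (· ∈ D.primeFactors)).card : ℝ) * n := by simp
        _ ≤ (D.primeFactors.card : ℝ) * n := by
            gcongr
            intro x hx
            exact (Finset.mem_filter.1 hx).2
        _ = _ := mul_comm _ _
    · intro l hl
      have := Nat.pos_of_mem_primeFactors (Finset.mem_filter.1 hl).1
      positivity

theorem coprime_part_dvd_prod_arith {D n u w a : ℕ} (h : n.factorial = u * w) (hu : u.Coprime D) :
    u ∣ ∏ k ∈ Finset.range n, (a + k * D) := by
  rcases Nat.eq_zero_or_pos u with rfl | hu0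
  · simp at h; exact absurd h (Nat.factorial_ne_zero n)
  obtain ⟨b, hb⟩ : ∃ b, D * b ≡ 1 [MOD u] := by
    obtain ⟨b, hb⟩ := Nat.exists_mul_mod_eq_of_coprime 1 hu.symm hu0.ne'
    exact ⟨b, hb.2⟩
  have hub : u.Coprime b := by
    have : (D * b).gcd u = 1 := by rw [hb.gcd_eq]; simp
    exact (Nat.Coprime.coprime_mul_left this).symm
  have h1 : b ^ n * ∏ k ∈ Finset.range n, (a + k * D) ≡ ∏ k ∈ Finset.range n, (a * b + k) [MOD u] := by
    have : b ^ n * ∏ k ∈ Finset.range n, (a + k * D) = ∏ k ∈ Finset.range n, (a * b + k * (D * b)) := by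
      rw [← Finset.card_range n, ← Finset.prod_const, Finset.card_range, ← Finset.prod_mul_distrib]
      exact Finset.prod_congr rfl fun k _ => by ring
    rw [this]
    exact Nat.ModEq.prod fun k _ => Nat.ModEq.add_left _ (by simpa using hb.mul_left k)
  have h2 : u ∣ ∏ k ∈ Finset.range n, (a * b + k) := by
    rw [← Nat.ascFactorial_eq_prod_range]
    exact (Dvd.intro _ h.symm).trans (Nat.factorial_dvd_ascFactorial _ _)
  exact (Nat.Coprime.pow_right n hub).dvd_of_dvd_mul_left ((h1.dvd_iff dvd_rfl).2 h2)

theorem sum_log_primes_arith_le {D n a : ℕ} (hD : 0 < D) (ha : 1 ≤ a) (haD : a ≤ D) (Q : Finset ℕ)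
    (hQ : ∀ q ∈ Q, q.Prime ∧ n < q ∧ ∃ k < n, q = a + k * D) :
    ∑ q ∈ Q, Real.log q ≤ n * (Real.log D + 1 + D.primeFactors.card) := by
  classical
  rcases Nat.eq_zero_or_pos n with rfl | hn
  · have : Q = ∅ := Finset.eq_empty_of_forall_notMem fun q hq => by
      obtain ⟨-, -, k, hk, -⟩ := hQ q hq
      omega
    simp [this]
  obtain ⟨u, w, huw, hu, hu0, hw0, hw⟩ := exists_coprime_part_factorial hD.ne' n
  have hT : u ∣ ∏ k ∈ Finset.range n, (a + k * D) := coprime_part_dvd_prod_arith huw hu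
  have hQT : ∏ q ∈ Q, q ∣ ∏ k ∈ Finset.range n, (a + k * D) := by
    have hinj : Set.InjOn (fun k => a + k * D) (Finset.range n : Set ℕ) := by
      intro x _ y _ hxy
      exact Nat.eq_of_mul_eq_mul_right hD (by simpa using hxy)
    rw [← Finset.prod_image (f := fun q => q) hinj]
    refine Finset.prod_dvd_prod_of_subset _ _ _ fun q hq => ?_
    obtain ⟨-, -, k, hk, rfl⟩ := hQ q hq
    exact Finset.mem_image.2 ⟨k, Finset.mem_range.2 hk, rfl⟩
  have hcop : (∏ q ∈ Q, q).Coprime u := by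
    refine Nat.Coprime.prod_left fun q hq => ?_
    obtain ⟨hp, hnq, -⟩ := hQ q hq
    refine (hp.coprime_iff_not_dvd).2 fun h => ?_
    have := (hp.dvd_factorial).1 (h.trans (Dvd.intro _ huw.symm))
    omega
  have hle : (∏ q ∈ Q, q) * u ≤ (n * D) ^ n := by
    refine (Nat.le_of_dvd ?_ (hcop.mul_dvd_of_dvd_of_dvd hQT hT)).trans ?_
    · exact Finset.prod_pos fun k _ => by omega
    · calc _ ≤ ∏ k ∈ Finset.range n, (n * D) := Finset.prod_le_prod' fun k hk => by
            have : k + 1 ≤ n := Finset.mem_range.1 hk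
            nlinarith
        _ = _ := by simp
  have hP0 : 0 < ∏ q ∈ Q, q := Finset.prod_pos fun q hq => (hQ q hq).1.pos
  have hlog : Real.log ((∏ q ∈ Q, q : ℕ) : ℝ) + Real.log u ≤ n * (Real.log n + Real.log D) := by
    rw [← Real.log_mul (by positivity) (by positivity), ← Real.log_mul (by positivity) (by positivity),
      ← Real.log_pow]
    exact Real.log_le_log (by positivity) (by exact_mod_cast hle)
  have hfac : (n : ℝ) * Real.log n - n ≤ Real.log u + Real.log w := by
    have h1 := Real.pow_div_factorial_le_exp (x := (n : ℝ)) (by positivity) n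
    have h2 := Real.log_le_log (by positivity) h1
    rw [Real.log_exp, Real.log_div (by positivity) (by positivity), Real.log_pow, huw, Nat.cast_mul,
      Real.log_mul (by positivity) (by positivity)] at h2
    linarith
  have hsum : Real.log ((∏ q ∈ Q, q : ℕ) : ℝ) = ∑ q ∈ Q, Real.log q := by
    rw [Nat.cast_prod, Real.log_prod]
    intro q hq
    have := (hQ q hq).1.pos
    positivity
  rw [hsum] at hlog
  linarith

/-- Primes up to `n * D` in a single residue class modulo `D`, Chebyshev style. -/
theorem sum_log_primes_modEq_le {D : ℕ} (hD : 4 ≤ D) (a : ℕ) (ha : 1 ≤ a) (haD : a ≤ D) (n : ℕ) (Q : Finset ℕ)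
    (hQ : ∀ q ∈ Q, q.Prime ∧ ∃ k < n, q = a + k * D) :
    ∑ q ∈ Q, Real.log q ≤ 2 * n * (Real.log D + 1 + D.primeFactors.card) := by
  classical
  have hL : 0 ≤ Real.log D + 1 + D.primeFactors.card := by positivity
  have hlD : 0 ≤ Real.log D := by positivity
  induction n using Nat.strong_induction_on generalizing Q with
  | _ n ih =>
  rcases Nat.lt_or_ge n 2 with hn | hn
  · interval_cases n
    · have : Q = ∅ := Finset.eq_empty_of_forall_notMem fun q hq => by
        obtain ⟨-, k, hk, -⟩ := hQ q hq
        omega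
      simp [this]
    · have hsub : Q ⊆ {a} := fun q hq => by
        obtain ⟨-, k, hk, rfl⟩ := hQ q hq
        have : k = 0 := by omega
        simp [this]
      calc _ ≤ ∑ q ∈ ({a} : Finset ℕ), Real.log q :=
            Finset.sum_le_sum_of_subset_of_nonneg hsub fun q _ _ => by positivity
        _ = Real.log a := by simp
        _ ≤ Real.log D := Real.log_le_log (by positivity) (by exact_mod_cast haD)
        _ ≤ _ := by push_cast; nlinarith [(Nat.cast_nonneg D.primeFactors.card : (0 : ℝ) ≤ _)]
  · rw [← Finset.sum_filter_add_sum_filter_not Q (fun q => n < q)]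
    have h1 := sum_log_primes_arith_le (n := n) (by omega) ha haD (Q.filter (n < ·)) (fun q hq => by
      obtain ⟨hq, hnq⟩ := Finset.mem_filter.1 hq
      exact ⟨(hQ q hq).1, hnq, (hQ q hq).2⟩)
    have hlt : n / D + 1 < n := by
      have : n / D ≤ n / 4 := Nat.div_le_div_left hD (by norm_num)
      rcases Nat.lt_or_ge n 4 with h | h
      · have : n / 4 = 0 := Nat.div_eq_of_lt h
        omega
      · omega
    have hm : 2 * ((n - 1) / D + 1) ≤ n := by
      have : (n - 1) / D ≤ (n - 1) / 4 := Nat.div_le_div_left hD (by norm_num)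
      omega
    have h2 := ih ((n - 1) / D + 1) (by omega) (Q.filter (¬ n < ·)) (fun q hq => by
      obtain ⟨hq, hnq⟩ := Finset.mem_filter.1 hq
      obtain ⟨hp, k, hk, rfl⟩ := hQ q hq
      refine ⟨hp, k, Nat.lt_succ_of_le ?_, rfl⟩
      rw [Nat.le_div_iff_mul_le (by omega)]
      omega)
    have h3 : 2 * (((n - 1) / D + 1 : ℕ) : ℝ) ≤ n := by exact_mod_cast hm
    nlinarith

theorem sum_log_primes_le_of_pairwise_modEq {D X : ℕ} (hD : 4 ≤ D) (Q : Finset ℕ)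
    (hp : ∀ q ∈ Q, q.Prime) (hX : ∀ q ∈ Q, q ≤ X)
    (hmod : ∀ q ∈ Q, ∀ r ∈ Q, q ≡ r [MOD D]) :
    ∑ q ∈ Q, Real.log q ≤ 2 * ((X : ℝ) / D + 1) * (Real.log D + 1 + D.primeFactors.card) := by
  have hL : 0 ≤ Real.log D + 1 + D.primeFactors.card := by positivity
  rcases Q.eq_empty_or_nonempty with rfl | ⟨q₀, hq₀⟩
  · simp only [Finset.sum_empty]; positivity
  have h := sum_log_primes_modEq_le hD ((q₀ - 1) % D + 1) (by omega)
    (Nat.mod_lt _ (by omega)) (X / D + 1) Q (fun q hq => by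
      refine ⟨hp q hq, (q - 1) / D, ?_, ?_⟩
      · exact Nat.lt_succ_of_le (Nat.div_le_div_right ((Nat.sub_le _ _).trans (hX q hq)))
      · have h1 := (hp q hq).pos
        have h2 := (hp q₀ hq₀).pos
        have h3 : q - 1 ≡ q₀ - 1 [MOD D] := by
          apply Nat.ModEq.add_right_cancel' 1
          rw [Nat.sub_add_cancel h1, Nat.sub_add_cancel h2]
          exact hmod q hq q₀ hq₀
        have h4 := Nat.mod_add_div' (q - 1) D
        rw [← show (q - 1) % D = (q₀ - 1) % D from h3]
        omega)
  refine h.trans ?_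
  gcongr
  push_cast
  gcongr
  exact Nat.cast_div_le

/-- The least power of `l` with exponent at least two that is at least `N`. -/
def leastPow (N l : ℕ) : ℕ := l ^ max 2 (Nat.clog l N)

theorem le_leastPow {N l : ℕ} (hl : 2 ≤ l) : N ≤ leastPow N l :=
  (Nat.le_pow_clog hl N).trans (Nat.pow_le_pow_right (by omega) (le_max_right _ _))

theorem sq_le_leastPow {N l : ℕ} (hl : 2 ≤ l) : l ^ 2 ≤ leastPow N l :=
  Nat.pow_le_pow_right (by omega) (le_max_left _ _)

theorem leastPow_dvd {N l i : ℕ} (hl : 2 ≤ l) (hi : 2 ≤ i) (h : N ≤ l ^ i) : leastPow N l ∣ l ^ i :=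
  pow_dvd_pow _ (max_le hi ((Nat.clog_le_iff_le_pow hl).2 h))

theorem log_add_div_antitone {c s t : ℝ} (hc : 1 ≤ c) (hs : 1 ≤ s) (hst : s ≤ t) :
    (Real.log t + c) / t ≤ (Real.log s + c) / s := by
  have hs0 : 0 < s := by linarith
  have ht0 : 0 < t := by linarith
  have h1 : Real.log t - Real.log s ≤ t / s - 1 := by
    rw [← Real.log_div ht0.ne' hs0.ne']
    exact Real.log_le_sub_one_of_pos (by positivity)
  have h2 : 1 ≤ t / s := (one_le_div hs0).2 hst
  have h3 : 0 ≤ Real.log s := Real.log_nonneg hs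
  rw [div_le_iff₀ ht0]
  have : (Real.log s + c) / s * t = (Real.log s + c) * (t / s) := by ring
  rw [this]
  nlinarith

theorem sum_log_div_leastPow_le {N : ℕ} (hN : 4 ≤ N) {c : ℝ} (hc : 2 ≤ c) (Z : ℕ) :
    ∑ l ∈ Finset.Icc 2 Z, (Real.log (leastPow N l) + c) / leastPow N l ≤
      (2 * Real.log N + 2 * c + 2) / Nat.sqrt N := by
  set y := Nat.sqrt N with hy
  have hy2 : 2 ≤ y := Nat.le_sqrt.2 (by omega)
  have hyN : y * y ≤ N := Nat.sqrt_le N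
  have hyR : (2 : ℝ) ≤ y := by exact_mod_cast hy2
  have hyNR : (y : ℝ) * y ≤ N := by exact_mod_cast hyN
  have hlogN : 0 ≤ Real.log N := by positivity
  have hterm : ∀ l, 2 ≤ l → 0 ≤ (Real.log (leastPow N l) + c) / leastPow N l := fun l hl => by
    have : 0 ≤ Real.log (leastPow N l) := by positivity
    have : 0 ≤ Real.log (leastPow N l) + c := by linarith
    positivity
  have hfirst : ∀ Z, Z ≤ y → ∑ l ∈ Finset.Icc 2 Z, (Real.log (leastPow N l) + c) / leastPow N l ≤
      (Real.log N + c) / y := by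
    intro Z hZ
    calc _ ≤ ∑ l ∈ Finset.Icc 2 Z, (Real.log N + c) / N := by
          refine Finset.sum_le_sum fun l hl => log_add_div_antitone (by linarith) ?_ ?_
          · exact_mod_cast (by omega : 1 ≤ N)
          · exact_mod_cast le_leastPow (Finset.mem_Icc.1 hl).1
      _ = ((Z + 1 - 2 : ℕ) : ℝ) * ((Real.log N + c) / N) := by simp
      _ ≤ y * ((Real.log N + c) / (y * y)) := by
          have : 0 ≤ Real.log N + c := by linarith
          gcongr
          omega
      _ = _ := by field_simp
  have hlogy : 2 * Real.log y ≤ Real.log N := by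
    rw [two_mul, ← Real.log_mul (by positivity) (by positivity)]
    exact Real.log_le_log (by positivity) hyNR
  have hsecond : ∀ Z, y ≤ Z → ∑ l ∈ Finset.Icc 2 Z, (Real.log (leastPow N l) + c) / leastPow N l ≤
      (Real.log N + c) / y + (2 * Real.log y + c + 2) / y - (2 * Real.log Z + c + 2) / Z := by
    intro Z hZ
    induction Z, hZ using Nat.le_induction with
    | base => have := hfirst y le_rfl; linarith
    | succ Z hZ ih =>
      rw [Finset.sum_Icc_succ_top (by omega)]
      have hZR : (2 : ℝ) ≤ Z := by exact_mod_cast hy2.trans hZ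
      have h1 : (Real.log (leastPow N (Z + 1)) + c) / leastPow N (Z + 1) ≤
          (2 * Real.log (Z + 1 : ℕ) + c) / ((Z : ℝ) + 1) ^ 2 := by
        have := log_add_div_antitone (c := c) (s := ((Z : ℝ) + 1) ^ 2) (t := leastPow N (Z + 1))
          (by linarith) (by nlinarith) (by exact_mod_cast sq_le_leastPow (by omega))
        rw [Real.log_pow] at this
        exact_mod_cast this
      have h2 : Real.log (Z + 1 : ℕ) - Real.log Z ≤ 1 / Z := by
        rw [← Real.log_div (by positivity) (by positivity)]
        refine (Real.log_le_sub_one_of_pos (by positivity)).trans (le_of_eq ?_)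
        push_cast
        field_simp
        ring
      have h3 : (2 * Real.log (Z + 1 : ℕ) + c) / ((Z : ℝ) + 1) ^ 2 ≤
          (2 * Real.log Z + c + 2) / Z - (2 * Real.log (Z + 1 : ℕ) + c + 2) / (Z + 1 : ℕ) := by
        set A := Real.log (Z + 1 : ℕ)
        have hA : 0 ≤ A := by positivity
        have h4 : (2 * A - 2 / Z + c + 2) / Z ≤ (2 * Real.log Z + c + 2) / Z := by
          gcongr
          have : 2 / (Z : ℝ) = 2 * (1 / Z) := by ring
          linarith
        have h5 : (2 * A + c) / ((Z : ℝ) + 1) ^ 2 ≤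
            (2 * A - 2 / Z + c + 2) / Z - (2 * A + c + 2) / (Z + 1 : ℕ) := by
          rw [← sub_nonneg]
          have : (2 * A - 2 / Z + c + 2) / Z - (2 * A + c + 2) / (Z + 1 : ℕ)
              - (2 * A + c) / ((Z : ℝ) + 1) ^ 2 =
              ((2 * A + c) * Z - 2 * (Z + 1)) / (Z ^ 2 * (Z + 1) ^ 2) := by
            push_cast
            field_simp
            ring
          rw [this]
          apply div_nonneg _ (by positivity)
          have hA2 : Real.log 2 ≤ A :=
            Real.log_le_log (by norm_num) (by exact_mod_cast (by omega : 2 ≤ Z + 1))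
          have := Real.log_two_gt_d9
          nlinarith
        linarith
      linarith
  rcases le_total Z y with h | h
  · refine (hfirst Z h).trans ?_
    exact div_le_div_of_nonneg_right (by linarith) (by positivity)
  · refine (hsecond Z h).trans ?_
    have h1 : 0 ≤ (2 * Real.log Z + c + 2) / Z :=
      div_nonneg (by have : 0 ≤ Real.log Z := by positivity
                     linarith) (by positivity)
    have h2 : (2 * Real.log y + c + 2) / y ≤ (Real.log N + c + 2) / y := by gcongr
    have h3 : (2 * Real.log N + 2 * c + 2) / (y : ℝ) =
        (Real.log N + c) / y + (Real.log N + c + 2) / y := by ring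
    linarith

theorem sum_log_primes_le_of_leastPow_dvd {N M X s : ℕ} (hN : 4 ≤ N) (hM : 0 < M) (hs : s ≤ X)
    (Q : Finset ℕ) (hp : ∀ q ∈ Q, q.Prime) (hX : ∀ q ∈ Q, q ≤ X)
    (hmod : ∀ q ∈ Q, ∀ r ∈ Q, q ≡ r [MOD M])
    (hbad : ∀ q ∈ Q, ∃ l, l.Prime ∧ ¬ l ∣ M ∧ leastPow N l ∣ q + s) {c : ℝ}
    (hc : c = Real.log M + 2 + M.primeFactors.card) :
    ∑ q ∈ Q, Real.log q ≤
      2 * X / M * ((2 * Real.log N + 2 * c + 2) / Nat.sqrt N) +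
        2 * √(2 * X) * (Real.log (2 * X) + c) := by
  classical
  have hc2 : 2 ≤ c := by
    have : 0 ≤ Real.log M := by positivity
    have : (0 : ℝ) ≤ M.primeFactors.card := by positivity
    linarith
  set Z := Nat.sqrt (2 * X)
  have hlogX : 0 ≤ Real.log (2 * X) := by
    have : Real.log (2 * X) = Real.log ((2 * X : ℕ) : ℝ) := by push_cast; rfl
    rw [this]; positivity
  have hcover : ∀ q ∈ Q, Real.log q ≤ ∑ l ∈ Finset.Icc 2 Z,
      if l.Prime ∧ ¬ l ∣ M ∧ leastPow N l ∣ q + s then Real.log q else 0 := by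
    intro q hq
    obtain ⟨l, hl, hlM, hd⟩ := hbad q hq
    have h1 := Nat.le_of_dvd (by have := (hp q hq).pos; omega) hd
    have h2 := sq_le_leastPow (N := N) hl.two_le
    have h3 := hX q hq
    have hmem : l ∈ Finset.Icc 2 Z := Finset.mem_Icc.2 ⟨hl.two_le, Nat.le_sqrt'.2 (by omega)⟩
    have h4 := Finset.single_le_sum (f := fun l =>
      if l.Prime ∧ ¬ l ∣ M ∧ leastPow N l ∣ q + s then Real.log q else 0)
      (fun i _ => by split_ifs <;> positivity) hmem
    simpa [hl, hlM, hd] using h4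
  have hfib : ∀ l ∈ Finset.Icc 2 Z,
      ∑ q ∈ Q.filter (fun q => l.Prime ∧ ¬ l ∣ M ∧ leastPow N l ∣ q + s), Real.log q ≤
        2 * X / M * ((Real.log (leastPow N l) + c) / leastPow N l) + 2 * (Real.log (2 * X) + c) := by
    intro l hl
    have hl2 := (Finset.mem_Icc.1 hl).1
    have hd0 : 0 < leastPow N l := lt_of_lt_of_le (by omega) (le_leastPow hl2)
    have hld : 0 ≤ Real.log (leastPow N l) := by positivity
    rcases Finset.eq_empty_or_nonempty
      (Q.filter (fun q => l.Prime ∧ ¬ l ∣ M ∧ leastPow N l ∣ q + s)) with h | ⟨q₀, hq₀⟩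
    · rw [h, Finset.sum_empty]
      have : 0 ≤ Real.log (leastPow N l) + c := by linarith
      have : 0 ≤ Real.log (2 * X) + c := by linarith
      positivity
    · obtain ⟨hq₀, hlp, hlM, hd₀⟩ := Finset.mem_filter.1 hq₀
      have hdX : leastPow N l ≤ 2 * X := by
        have h1 := Nat.le_of_dvd (by have := (hp q₀ hq₀).pos; omega) hd₀
        have h3 := hX q₀ hq₀
        omega
      have hcop : (leastPow N l).Coprime M := ((hlp.coprime_iff_not_dvd).2 hlM).pow_left _
      have h := sum_log_primes_le_of_pairwise_modEq (D := leastPow N l * M) (X := X)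
        (by have := le_leastPow (N := N) hl2; nlinarith)
        (Q.filter (fun q => l.Prime ∧ ¬ l ∣ M ∧ leastPow N l ∣ q + s))
        (fun q hq => hp q (Finset.mem_filter.1 hq).1) (fun q hq => hX q (Finset.mem_filter.1 hq).1)
        (fun q hq r hr => by
          obtain ⟨hq, -, -, hdq⟩ := Finset.mem_filter.1 hq
          obtain ⟨hr, -, -, hdr⟩ := Finset.mem_filter.1 hr
          refine (Nat.modEq_and_modEq_iff_modEq_mul hcop).1 ⟨?_, hmod q hq r hr⟩
          exact Nat.ModEq.add_right_cancel' s (((Nat.modEq_zero_iff_dvd).2 hdq).trans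
            ((Nat.modEq_zero_iff_dvd).2 hdr).symm))
      have hcard : (((leastPow N l * M).primeFactors.card : ℕ) : ℝ) ≤ 1 + M.primeFactors.card := by
        rw [hcop.primeFactors_mul]
        have h1 : (leastPow N l).primeFactors = {l} :=
          Nat.primeFactors_prime_pow (by have := le_max_left 2 (Nat.clog l N); omega) hlp
        have := Finset.card_union_le (leastPow N l).primeFactors M.primeFactors
        rw [h1, Finset.card_singleton] at this
        rw [h1]
        exact_mod_cast this
      have hlogd : Real.log (leastPow N l) ≤ Real.log (2 * X) :=
        Real.log_le_log (by positivity) (by exact_mod_cast hdX)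
      rw [Nat.cast_mul, Real.log_mul (by positivity) (by positivity)] at h
      have hE : Real.log (leastPow N l) + Real.log M + 1 + ((leastPow N l * M).primeFactors.card : ℝ) ≤
          Real.log (leastPow N l) + c := by linarith
      calc _ ≤ _ := h
        _ ≤ 2 * ((X : ℝ) / (leastPow N l * M) + 1) * (Real.log (leastPow N l) + c) := by gcongr
        _ = 2 * X / M * ((Real.log (leastPow N l) + c) / leastPow N l) +
            2 * (Real.log (leastPow N l) + c) := by field_simp
        _ ≤ _ := by gcongr
  calc ∑ q ∈ Q, Real.log q ≤ ∑ q ∈ Q, ∑ l ∈ Finset.Icc 2 Z,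
      (if l.Prime ∧ ¬ l ∣ M ∧ leastPow N l ∣ q + s then Real.log q else 0) :=
        Finset.sum_le_sum hcover
    _ = ∑ l ∈ Finset.Icc 2 Z, ∑ q ∈ Q.filter (fun q => l.Prime ∧ ¬ l ∣ M ∧ leastPow N l ∣ q + s),
        Real.log q := by
          rw [Finset.sum_comm]
          exact Finset.sum_congr rfl fun l _ => (Finset.sum_filter _ _).symm
    _ ≤ ∑ l ∈ Finset.Icc 2 Z, (2 * X / M * ((Real.log (leastPow N l) + c) / leastPow N l) +
        2 * (Real.log (2 * X) + c)) := Finset.sum_le_sum hfib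
    _ = 2 * X / M * (∑ l ∈ Finset.Icc 2 Z, (Real.log (leastPow N l) + c) / leastPow N l) +
        ((Z + 1 - 2 : ℕ) : ℝ) * (2 * (Real.log (2 * X) + c)) := by
          rw [Finset.sum_add_distrib, ← Finset.mul_sum]
          simp
    _ ≤ 2 * X / M * ((2 * Real.log N + 2 * c + 2) / Nat.sqrt N) +
        √(2 * X) * (2 * (Real.log (2 * X) + c)) := by
          have h1 := sum_log_div_leastPow_le hN (c := c) (by linarith) Z
          have h2 : ((Z + 1 - 2 : ℕ) : ℝ) ≤ √(2 * X) := by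
            have h3 : (Z : ℝ) ≤ √((2 * X : ℕ) : ℝ) := Real.nat_sqrt_le_real_sqrt
            have h4 : ((Z + 1 - 2 : ℕ) : ℝ) ≤ Z := by exact_mod_cast (by omega : Z + 1 - 2 ≤ Z)
            push_cast at h3
            linarith
          gcongr
    _ = _ := by ring

/-- Every proper prime power dividing `n` is smaller than `N`. -/
def Tame (N n : ℕ) : Prop := ∀ l i : ℕ, l.Prime → 2 ≤ i → l ^ i ∣ n → l ^ i < N

theorem exists_leastPow_dvd_of_not_tame {N n : ℕ} (h : ¬ Tame N n) :
    ∃ l, l.Prime ∧ leastPow N l ∣ n := by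
  simp only [Tame, not_forall, not_lt] at h
  obtain ⟨l, i, hl, hi, hd, hN⟩ := h
  exact ⟨l, hl, (leastPow_dvd hl.two_le hi hN).trans hd⟩

theorem eq_natCast_of_prime_powers {f : ℕ → ℂ} (hf1 : f 1 = 1)
    (hmul : ∀ m n : ℕ, Nat.Coprime m n → f (m * n) = f m * f n) (n : ℕ) (hn : 0 < n)
    (h : ∀ l i : ℕ, l.Prime → 1 ≤ i → l ^ i ∣ n → f (l ^ i) = ((l ^ i : ℕ) : ℂ)) :
    f n = n := by
  induction n using Nat.recOnPosPrimePosCoprime with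
  | prime_pow p i hp hi => exact h p i hp hi dvd_rfl
  | zero => omega
  | one => simpa using hf1
  | coprime a b ha hb hab iha ihb =>
    rw [hmul a b hab, iha (by omega) fun l i hl hi hd => h l i hl hi (hd.mul_right _),
      ihb (by omega) fun l i hl hi hd => h l i hl hi (hd.mul_left _), Nat.cast_mul]

theorem eq_natCast_of_tame {f : ℕ → ℂ} (hf1 : f 1 = 1)
    (hmul : ∀ m n : ℕ, Nat.Coprime m n → f (m * n) = f m * f n) {N n : ℕ} (hn : 0 < n)
    (hlt : ∀ m, 0 < m → m < N → f m = m) (ht : Tame N n)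
    (hprime : ∀ l, l.Prime → l ∣ n → f l = l) : f n = n := by
  refine eq_natCast_of_prime_powers hf1 hmul n hn fun l i hl hi hd => ?_
  rcases hi.lt_or_eq with hi | rfl
  · exact hlt _ (pow_pos hl.pos _) (ht l i hl hi hd)
  · rw [pow_one] at hd ⊢
    exact hprime l hl hd

theorem log_one_thousand_le : Real.log 1000 ≤ 6.94 := by
  have h1 : Real.log 1000 ≤ Real.log (2 ^ 10) := Real.log_le_log (by norm_num) (by norm_num)
  rw [Real.log_pow] at h1
  have := Real.log_two_lt_d9
  push_cast at h1
  linarith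

theorem log_le_of_pos {z : ℝ} (hz : 0 < z) : Real.log z ≤ 5.94 + z / 1000 := by
  have h1 := Real.log_le_sub_one_of_pos (x := z / 1000) (by positivity)
  rw [Real.log_div hz.ne' (by norm_num)] at h1
  linarith [log_one_thousand_le]

theorem exists_prime_lt_tame {r : ℕ} (hr : 10 ^ 6 ≤ r) :
    ∃ q, q.Prime ∧ q ≠ 2 ∧ q < r ∧ Tame (10 ^ 6) (q + (r - 2)) := by
  by_contra! hcon
  have hmem : ∀ q ∈ (Nat.primesLE (r - 1)).erase 2, q.Prime ∧ q ≠ 2 ∧ q < r := fun q hq => by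
    obtain ⟨h2, hq⟩ := Finset.mem_erase.1 hq
    rw [Nat.mem_primesLE] at hq
    exact ⟨hq.2, h2, by omega⟩
  have hup := sum_log_primes_le_of_leastPow_dvd (N := 10 ^ 6) (M := 1) (X := r) (s := r - 2)
    (by norm_num) one_pos (by omega) ((Nat.primesLE (r - 1)).erase 2)
    (fun q hq => (hmem q hq).1) (fun q hq => (hmem q hq).2.2.le)
    (fun q _ t _ => Nat.modEq_one)
    (fun q hq => by
      obtain ⟨l, hl, hd⟩ := exists_leastPow_dvd_of_not_tame
        (hcon q (hmem q hq).1 (hmem q hq).2.1 (hmem q hq).2.2)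
      exact ⟨l, hl, hl.one_lt.ne' ∘ Nat.dvd_one.1, hd⟩) (c := 2) (by simp)
  have hlow := Chebyshev.theta_ge (r - 1)
  rw [Chebyshev.theta_eq_sum_primesLE_log, ← Finset.add_sum_erase _ _
    (show 2 ∈ Nat.primesLE (r - 1) from Nat.mem_primesLE.2 ⟨by omega, Nat.prime_two⟩)] at hlow
  have hsq : Nat.sqrt (10 ^ 6) = 1000 := by
    rw [show (10 ^ 6 : ℕ) = 1000 * 1000 by norm_num, Nat.sqrt_eq]
  rw [hsq] at hup
  rw [Nat.cast_sub (by omega)] at hlow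
  have hrR : (10 : ℝ) ^ 6 ≤ r := by exact_mod_cast hr
  generalize (∑ q ∈ (Nat.primesLE (r - 1)).erase 2, Real.log q) = S at hup hlow
  generalize (r : ℝ) = x at *
  have hx0 : 0 < x := by linarith
  obtain ⟨z, hz, rfl⟩ : ∃ z : ℝ, 1000 ≤ z ∧ x = z ^ 2 :=
    ⟨√x, Real.le_sqrt_of_sq_le (by linarith), (Real.sq_sqrt hx0.le).symm⟩
  have hz0 : 0 < z := by linarith
  have hlz := log_le_of_pos hz0
  have h2u := Real.log_two_lt_d9
  have h2l := Real.log_two_gt_d9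
  have hN : Real.log ((10 ^ 6 : ℕ) : ℝ) ≤ 13.88 := by
    have : ((10 ^ 6 : ℕ) : ℝ) = 1000 ^ 2 := by norm_num
    rw [this, Real.log_pow]
    have := log_one_thousand_le
    push_cast
    linarith
  have hlog2x : Real.log (2 * z ^ 2) ≤ 12.59 + z / 500 := by
    rw [Real.log_mul (by norm_num) (by positivity), Real.log_pow]
    push_cast
    linarith
  have hs2 : √(2 * z ^ 2) ≤ 1.415 * z :=
    Real.sqrt_le_iff.2 ⟨by positivity, by nlinarith⟩
  have hs1 : √(z ^ 2 - (1 : ℕ)) ≤ z :=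
    Real.sqrt_le_iff.2 ⟨by positivity, by push_cast; linarith⟩
  have hl1 : Real.log (z ^ 2 - (1 : ℕ)) ≤ 11.88 + z / 500 := by
    have : Real.log (z ^ 2 - (1 : ℕ)) ≤ Real.log (z ^ 2) :=
      Real.log_le_log (by push_cast; nlinarith) (by push_cast; linarith)
    rw [Real.log_pow] at this
    push_cast at this ⊢
    linarith
  have hl2 : Real.log (z ^ 2 - (1 : ℕ) + 1) ≤ 11.88 + z / 500 := by
    rw [Nat.cast_one, sub_add_cancel, Real.log_pow]
    push_cast
    linarith
  have hup2 : S ≤ 0.0676 * z ^ 2 + 2.83 * z * (14.59 + z / 500) := by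
    refine hup.trans ?_
    have h1 : 2 * z ^ 2 / ((1 : ℕ) : ℝ) * ((2 * Real.log ((10 ^ 6 : ℕ) : ℝ) + 2 * 2 + 2) / (1000 : ℕ)) ≤
        2 * z ^ 2 / ((1 : ℕ) : ℝ) * ((2 * 13.88 + 2 * 2 + 2) / (1000 : ℕ)) := by gcongr
    have h2 : 2 * √(2 * z ^ 2) * (Real.log (2 * z ^ 2) + 2) ≤
        2 * (1.415 * z) * (12.59 + z / 500 + 2) := by
      have : 0 ≤ Real.log (2 * z ^ 2) := Real.log_nonneg (by nlinarith)
      gcongr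
    norm_num at h1 h2 ⊢
    nlinarith
  have hlow2 : z ^ 2 * 0.69 - 0.7 - (11.88 + z / 500) - 2 * z * (11.88 + z / 500) - 0.7 ≤ S := by
    have h1 : 2 * √(z ^ 2 - (1 : ℕ)) * Real.log (z ^ 2 - (1 : ℕ)) ≤ 2 * z * (11.88 + z / 500) := by
      have : 0 ≤ Real.log (z ^ 2 - (1 : ℕ)) := Real.log_nonneg (by push_cast; nlinarith)
      gcongr
    push_cast at h1 hl2 hlow
    nlinarith
  nlinarith

theorem eq_natCast_prime_sub_one {f : ℕ → ℂ} (hf1 : f 1 = 1)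
    (hmul : ∀ m n : ℕ, Nat.Coprime m n → f (m * n) = f m * f n)
    (hadd : ∀ p q : ℕ, p.Prime → q.Prime → f (p - 1 + (q - 1)) = f (p - 1) + f (q - 1))
    (hlt : ∀ m, 0 < m → m < 10 ^ 6 → f m = m) (r : ℕ) (hr : r.Prime) :
    f (r - 1) = ((r - 1 : ℕ) : ℂ) := by
  induction r using Nat.strong_induction_on with
  | _ r ih =>
  rcases Nat.lt_or_ge r (10 ^ 6) with h | h
  · exact hlt _ (Nat.sub_pos_of_lt hr.one_lt) (by omega)
  obtain ⟨q, hq, hq2, hqr, ht⟩ := exists_prime_lt_tame h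
  have hrodd : r % 2 = 1 := hr.eq_two_or_odd.resolve_left (by omega)
  have hqodd : q % 2 = 1 := hq.eq_two_or_odd.resolve_left hq2
  have hsum := hadd r q hr hq
  have he : r - 1 + (q - 1) = q + (r - 2) := by have := hq.pos; omega
  rw [he, ih q hqr hq, eq_natCast_of_tame hf1 hmul (by omega) hlt ht] at hsum
  · have hc : ((q + (r - 2) : ℕ) : ℂ) = ((r - 1 : ℕ) : ℂ) + ((q - 1 : ℕ) : ℂ) := by
      rw [← he, Nat.cast_add]
    rw [hc] at hsum
    exact (add_right_cancel hsum).symm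
  · intro l hl hd
    have hlr : l < r := by
      rcases hl.eq_two_or_odd with rfl | hodd
      · omega
      · obtain ⟨k, hk⟩ := hd
        have : k ≠ 0 := by rintro rfl; omega
        have : k ≠ 1 := by rintro rfl; omega
        have := Nat.mul_le_mul_left l (show 2 ≤ k by omega)
        omega
    have h1 := hadd l 2 hl Nat.prime_two
    norm_num at h1
    rw [Nat.sub_add_cancel hl.pos, ih l hlr hl, hf1] at h1
    rw [h1]
    have := hl.pos
    push_cast [Nat.cast_sub (show 1 ≤ l from this)]
    ring

theorem sum_mul_antitone_le {a w : ℕ → ℝ} {α C : ℝ} (hC : 0 ≤ C)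
    (hw : ∀ n, 1 ≤ n → w (n + 1) ≤ w n) (hw0 : ∀ n, 0 ≤ w n)
    (ha : ∀ K : ℕ, ∑ n ∈ Finset.Icc 1 K, a n ≤ α * K + C) (K : ℕ) :
    ∑ n ∈ Finset.Icc 1 K, a n * w n ≤ α * ∑ n ∈ Finset.Icc 1 K, w n + C * w 1 := by
  rcases Nat.eq_zero_or_pos K with rfl | hK
  · simpa using mul_nonneg hC (hw0 1)
  have key : ∑ n ∈ Finset.Icc 1 K, a n * w n ≤ α * ∑ n ∈ Finset.Icc 1 K, w n +
      (∑ n ∈ Finset.Icc 1 K, a n - α * K) * w K + C * (w 1 - w K) := by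
    induction K, hK using Nat.le_induction with
    | base => simp; linarith
    | succ K hK ih =>
      rw [Finset.sum_Icc_succ_top (by omega), Finset.sum_Icc_succ_top (by omega),
        Finset.sum_Icc_succ_top (by omega)]
      have h1 := ha K
      have h2 := hw K hK
      push_cast
      nlinarith [mul_nonneg (sub_nonneg.2 h1) (sub_nonneg.2 h2)]
  have h1 := mul_nonneg (sub_nonneg.2 (ha K)) (hw0 K)
  nlinarith

theorem sum_rpow_neg_le {x : ℝ} (hx : 1 < x) (K : ℕ) :
    ∑ n ∈ Finset.Icc 1 K, (n : ℝ) ^ (-x) ≤ 1 + 1 / (x - 1) := by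
  have he : 0 < x - 1 := by linarith
  rcases Nat.eq_zero_or_pos K with rfl | hK
  · simp; positivity
  have key : ∑ n ∈ Finset.Icc 1 K, (n : ℝ) ^ (-x) ≤
      1 + (1 - (K : ℝ) ^ (-(x - 1))) / (x - 1) := by
    induction K, hK using Nat.le_induction with
    | base => simp
    | succ K hK ih =>
      rw [Finset.sum_Icc_succ_top (by omega)]
      have hK0 : (0 : ℝ) < K := by exact_mod_cast hK
      have hK1 : (0 : ℝ) < (K + 1 : ℕ) := by positivity
      set e := x - 1
      have h1 : ((K + 1 : ℕ) : ℝ) ^ (-x) = ((K + 1 : ℕ) : ℝ) ^ (-e) / (K + 1 : ℕ) := by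
        rw [show -x = -e - 1 by simp only [e]; ring, Real.rpow_sub_one hK1.ne']
      have h2 : ((K + 1 : ℕ) : ℝ) ^ (-e) * (1 + e / (K + 1 : ℕ)) ≤ (K : ℝ) ^ (-e) := by
        have h3 : Real.log K ≤ Real.log (K + 1 : ℕ) - 1 / (K + 1 : ℕ) := by
          have := Real.log_le_sub_one_of_pos (x := (K : ℝ) / (K + 1 : ℕ)) (by positivity)
          rw [Real.log_div hK0.ne' hK1.ne'] at this
          have h4 : (K : ℝ) / (K + 1 : ℕ) - 1 = - (1 / (K + 1 : ℕ)) := by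
            push_cast
            field_simp
            ring
          linarith
        rw [Real.rpow_def_of_pos hK1, Real.rpow_def_of_pos hK0]
        calc _ ≤ Real.exp (Real.log (K + 1 : ℕ) * -e) * Real.exp (e / (K + 1 : ℕ)) := by
              gcongr
              linarith [Real.add_one_le_exp (e / (K + 1 : ℕ))]
          _ = Real.exp (Real.log (K + 1 : ℕ) * -e + e / (K + 1 : ℕ)) := (Real.exp_add _ _).symm
          _ ≤ _ := by
              gcongr
              have : e / (K + 1 : ℕ) = e * (1 / (K + 1 : ℕ)) := by ring
              nlinarith
      have h5 : ((K + 1 : ℕ) : ℝ) ^ (-e) / (K + 1 : ℕ) ≤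
          ((K : ℝ) ^ (-e) - ((K + 1 : ℕ) : ℝ) ^ (-e)) / e := by
        rw [le_div_iff₀ he]
        have : ((K + 1 : ℕ) : ℝ) ^ (-e) / (K + 1 : ℕ) * e =
          ((K + 1 : ℕ) : ℝ) ^ (-e) * (e / (K + 1 : ℕ)) := by ring
        linarith
      rw [h1]
      have : (1 - ((K + 1 : ℕ) : ℝ) ^ (-e)) / e = (1 - (K : ℝ) ^ (-e)) / e +
        ((K : ℝ) ^ (-e) - ((K + 1 : ℕ) : ℝ) ^ (-e)) / e := by ring
      linarith
  refine key.trans ?_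
  gcongr
  have : 0 ≤ (K : ℝ) ^ (-(x - 1)) := by positivity
  linarith

open ArithmeticFunction vonMangoldt in
/-- Primes in a residue class have upper density at least `1 / φ M` with respect to `log`. -/
theorem not_sum_log_primes_class_le {M : ℕ} [NeZero M] {a : ZMod M} (ha : IsUnit a) {α C₀ : ℝ}
    (hα : α < (M.totient : ℝ)⁻¹) (hC₀ : 0 ≤ C₀)
    (h : ∀ X : ℕ, ∑ q ∈ (Finset.Icc 1 X).filter (fun q : ℕ => q.Prime ∧ (q : ZMod M) = a), Real.log q ≤
      α * X + C₀) : False := by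
  classical
  obtain ⟨C, hC⟩ := LSeries_residueClass_lower_bound ha
  have hα0 : 0 ≤ α := by
    by_contra! hneg
    obtain ⟨X, hX⟩ := exists_nat_gt (C₀ / (-α))
    have h1 := h X
    have h2 : 0 ≤ ∑ q ∈ (Finset.Icc 1 X).filter (fun q : ℕ => q.Prime ∧ (q : ZMod M) = a), Real.log q :=
      Finset.sum_nonneg fun q _ => by positivity
    rw [div_lt_iff₀ (by linarith)] at hX
    linarith
  set C₁ := ∑' n : ℕ, (if n.Prime then 0 else residueClass a n) / n with hC₁
  have hup : ∀ x : ℝ, 1 < x →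
      ∑' n, residueClass a n / (n : ℝ) ^ x ≤ α * (1 + 1 / (x - 1)) + C₀ + C₁ := by
    intro x hx
    refine Real.tsum_le_of_sum_range_le (fun n => div_nonneg (residueClass_nonneg a n) (by positivity))
      fun K => ?_
    have hterm : ∀ n ∈ Finset.range K, residueClass a n / (n : ℝ) ^ x ≤
        (if n.Prime then residueClass a n else 0) * (n : ℝ) ^ (-x) +
          (if n.Prime then 0 else residueClass a n) / n := by
      intro n _
      have h0 := residueClass_nonneg a n
      split_ifs with hn
      · rw [Real.rpow_neg (by positivity), div_eq_mul_inv]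
        simp
      · rcases Nat.eq_zero_or_pos n with rfl | hn0
        · simp
        · have : (n : ℝ) ≤ (n : ℝ) ^ x :=
            Real.self_le_rpow_of_one_le (by exact_mod_cast hn0) hx.le
          rw [zero_mul, zero_add]
          gcongr
    have h1 : ∑ n ∈ Finset.range K, (if n.Prime then 0 else residueClass a n) / (n : ℝ) ≤ C₁ :=
      (summable_residueClass_non_primes_div a).sum_le_tsum _ fun n _ =>
        div_nonneg (by split_ifs; exacts [le_rfl, residueClass_nonneg a n]) (by positivity)
    have h2 : ∑ n ∈ Finset.range K, (if n.Prime then residueClass a n else 0) * (n : ℝ) ^ (-x) ≤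
        ∑ n ∈ Finset.Icc 1 K, (if n.Prime then residueClass a n else 0) * (n : ℝ) ^ (-x) := by
      have hnn : ∀ n : ℕ, 0 ≤ (if n.Prime then residueClass a n else 0) * (n : ℝ) ^ (-x) := fun n =>
        mul_nonneg (by split_ifs; exacts [residueClass_nonneg a n, le_rfl]) (by positivity)
      calc _ ≤ ∑ n ∈ insert 0 (Finset.Icc 1 K),
            (if n.Prime then residueClass a n else 0) * (n : ℝ) ^ (-x) := by
            refine Finset.sum_le_sum_of_subset_of_nonneg (fun n hn => ?_) fun n _ _ => hnn n
            have := Finset.mem_range.1 hn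
            simp only [Finset.mem_insert, Finset.mem_Icc]
            omega
        _ = _ := by
            rw [Finset.sum_insert (by simp)]
            simp
    have h3 := sum_mul_antitone_le (a := fun n => if n.Prime then residueClass a n else 0)
      (w := fun n => (n : ℝ) ^ (-x)) (α := α) (C := C₀) hC₀
      (fun n hn => by
        have : (0 : ℝ) < n := by exact_mod_cast hn
        exact Real.rpow_le_rpow_of_nonpos this (by push_cast; linarith) (by linarith))
      (fun n => by positivity)
      (fun X => by
        refine le_of_eq_of_le ?_ (h X)
        rw [Finset.sum_filter]
        refine Finset.sum_congr rfl fun n _ => ?_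
        by_cases hn : n.Prime
        · by_cases hna : (n : ZMod M) = a
          · simp [hn, hna, residueClass, vonMangoldt_apply_prime hn]
          · simp [hn, hna, residueClass]
        · simp [hn]) K
    have h4 := mul_le_mul_of_nonneg_left (sum_rpow_neg_le hx K) hα0
    simp only [Nat.cast_one, Real.one_rpow, mul_one] at h3
    have h5 := Finset.sum_le_sum hterm
    rw [Finset.sum_add_distrib] at h5
    linarith
  set δ := (M.totient : ℝ)⁻¹ - α
  have hδ : 0 < δ := sub_pos.2 hα
  set B := |C + α + C₀ + C₁|
  have hB : 0 ≤ B := abs_nonneg _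
  have hB' : C + α + C₀ + C₁ ≤ B := le_abs_self _
  have hden : 0 < B + δ + 1 := by linarith
  set x := 1 + δ / (B + δ + 1)
  have hx1 : x - 1 = δ / (B + δ + 1) := by simp [x]
  have hx : 1 < x := by
    have : 0 < δ / (B + δ + 1) := by positivity
    linarith
  have hx2 : x ≤ 2 := by
    have : δ / (B + δ + 1) ≤ 1 := (div_le_one hden).2 (by linarith)
    linarith
  have h1 := (hC ⟨hx, hx2⟩).trans (hup x hx)
  have h2 : δ / (x - 1) = B + δ + 1 := by
    rw [hx1]
    field_simp
  have h3 : δ / (x - 1) = (M.totient : ℝ)⁻¹ / (x - 1) - α * (1 / (x - 1)) := by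
    simp only [δ]
    ring
  linarith

/-- `√X log X` is eventually dominated by any multiple of `X`. -/
theorem exists_sqrt_mul_log_le {ε c : ℝ} (hε : 0 < ε) (hc : 0 ≤ c) :
    ∃ C : ℝ, 0 ≤ C ∧ ∀ X : ℕ, 2 * √(2 * X) * (Real.log (2 * X) + c) ≤ ε * X + C := by
  set β := ε / (2 * (8 + 2 * c)) with hβ
  have hβ0 : 0 < β := by positivity
  refine ⟨8 / β ^ 3 + 2 * c / β, by positivity, fun X => ?_⟩
  set u := √(√(2 * X)) with hu
  have hu0 : 0 ≤ u := Real.sqrt_nonneg _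
  have hu2 : √(2 * X) = u ^ 2 := (Real.sq_sqrt (Real.sqrt_nonneg _)).symm
  have hu4 : 2 * (X : ℝ) = u ^ 4 := by
    rw [show u ^ 4 = (u ^ 2) ^ 2 by ring, ← hu2, Real.sq_sqrt (by positivity)]
  have hlog : Real.log (u ^ 4) ≤ 4 * u := by
    rw [Real.log_pow]
    have := Real.log_le_self hu0
    push_cast
    linarith
  have h3 : u ^ 3 ≤ β * u ^ 4 + 1 / β ^ 3 := by
    rcases le_total 1 (β * u) with h | h
    · have : 0 ≤ 1 / β ^ 3 := by positivity
      nlinarith [pow_nonneg hu0 3]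
    · have h1 : (β * u) ^ 3 ≤ 1 := pow_le_one₀ (by positivity) h
      have : u ^ 3 ≤ 1 / β ^ 3 := by
        rw [le_div_iff₀ (by positivity)]
        linarith [mul_pow β u 3]
      have : 0 ≤ β * u ^ 4 := by positivity
      linarith
  have h2 : u ^ 2 ≤ β * u ^ 4 + 1 / β := by
    have h1 : 0 ≤ (β * u ^ 2 - 1) ^ 2 / β := by positivity
    have : (β * u ^ 2 - 1) ^ 2 / β = β * u ^ 4 + 1 / β - 2 * u ^ 2 := by
      field_simp
      ring
    nlinarith
  have hX : (X : ℝ) = u ^ 4 / 2 := by linarith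
  rw [hu2, hu4, hX]
  calc 2 * u ^ 2 * (Real.log (u ^ 4) + c) ≤ 2 * u ^ 2 * (4 * u + c) := by gcongr
    _ = 8 * u ^ 3 + 2 * c * u ^ 2 := by ring
    _ ≤ 8 * (β * u ^ 4 + 1 / β ^ 3) + 2 * c * (β * u ^ 4 + 1 / β) := by gcongr
    _ = β * (8 + 2 * c) * u ^ 4 + (8 / β ^ 3 + 2 * c / β) := by ring
    _ = _ := by
      have : β * (8 + 2 * c) = ε / 2 := by
        rw [hβ]
        field_simp
      rw [this]
      ring

theorem exists_prime_modEq_tame {p k : ℕ} (hp : p.Prime) (hk : 2 ≤ k) (hN : 10 ^ 6 ≤ p ^ k) :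
    ∃ q m, q.Prime ∧ q + 1 = p ^ k * m ∧ ¬ p ∣ m ∧ Tame (p ^ k) m := by
  by_contra! hcon
  set N := p ^ k with hNdef
  set M := N * p with hMdef
  have hp2 := hp.two_le
  have hM0 : 0 < M := by positivity
  have : NeZero M := ⟨hM0.ne'⟩
  have hMpow : M = p ^ (k + 1) := (pow_succ p k).symm
  have hpN : p ∣ N := dvd_pow_self p (by omega)
  have hcop : (N - 1).Coprime M := by
    rw [hMpow]
    refine (Nat.Coprime.pow_right _ ?_)
    refine ((hp.coprime_iff_not_dvd).2 fun h => ?_).symm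
    have h2 : p ∣ N - (N - 1) := Nat.dvd_sub hpN h
    rw [show N - (N - 1) = 1 by omega] at h2
    exact hp.one_lt.ne' (Nat.dvd_one.1 h2)
  have hcl : ∀ q : ℕ, q.Prime → (q : ZMod M) = ((N - 1 : ℕ) : ZMod M) →
      ∃ l, l.Prime ∧ ¬ l ∣ M ∧ leastPow N l ∣ q + 1 := by
    intro q hq hqc
    have hmod : q + 1 ≡ N [MOD M] := by
      have := ((ZMod.natCast_eq_natCast_iff _ _ _).1 hqc).add_right 1
      rwa [Nat.sub_add_cancel (by omega)] at this
    obtain ⟨m, hm⟩ : N ∣ q + 1 := ((hmod.of_mul_right p).dvd_iff dvd_rfl).2 dvd_rfl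
    have hm1 : m ≡ 1 [MOD p] := by
      rw [hm] at hmod
      refine Nat.ModEq.mul_left_cancel' (c := N) (by omega) ?_
      rwa [mul_one]
    have hpm : ¬ p ∣ m := fun h =>
      hp.one_lt.ne' (Nat.dvd_one.1 ((hm1.dvd_iff dvd_rfl).1 h))
    obtain ⟨l, hl, hd⟩ := exists_leastPow_dvd_of_not_tame (hcon q m hq hm hpm)
    refine ⟨l, hl, fun hlM => hpm ?_, hm ▸ hd.mul_left N⟩
    rw [hMpow] at hlM
    rw [← (Nat.prime_dvd_prime_iff_eq hl hp).1 (hl.dvd_of_dvd_pow hlM)]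
    exact (dvd_pow_self l (by have := le_max_left 2 (Nat.clog l N); omega)).trans hd
  set c : ℝ := Real.log M + 3 with hc
  have hMR : (0 : ℝ) < M := by exact_mod_cast hM0
  have hlogM0 : 0 ≤ Real.log M := by positivity
  obtain ⟨C, hC0, hC⟩ := exists_sqrt_mul_log_le (ε := 1 / (4 * M)) (c := c) (by positivity)
    (by linarith)
  set y := Nat.sqrt N with hy
  have hy1000 : 1000 ≤ y := Nat.le_sqrt.2 (by omega)
  have hNy : N < (y + 1) * (y + 1) := Nat.lt_succ_sqrt N
  have hyR : (1000 : ℝ) ≤ y := by exact_mod_cast hy1000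
  have hN0 : (0 : ℝ) < N := by exact_mod_cast (by omega : 0 < N)
  have hlogN : Real.log N ≤ 2 * (5.94 + ((y : ℝ) + 1) / 1000) := by
    have h1 : Real.log N ≤ Real.log (((y : ℝ) + 1) ^ 2) :=
      Real.log_le_log hN0 (by rw [sq]; exact_mod_cast hNy.le)
    rw [Real.log_pow] at h1
    have h2 := log_le_of_pos (z := (y : ℝ) + 1) (by linarith)
    push_cast at h1
    linarith
  have hlogM : Real.log M ≤ 3 / 2 * Real.log N := by
    have h1 : p ^ 2 ≤ N := Nat.pow_le_pow_right (by omega) hk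
    have h2 : 2 * Real.log p ≤ Real.log N := by
      have := Real.log_le_log (x := (p : ℝ) ^ 2) (y := (N : ℝ)) (by positivity) (by exact_mod_cast h1)
      rw [Real.log_pow] at this
      exact_mod_cast this
    rw [hMdef, Nat.cast_mul, Real.log_mul hN0.ne' (by positivity)]
    linarith
  have hratio : (2 * Real.log N + 2 * c + 2) / (y : ℝ) ≤ 1 / 8 := by
    rw [div_le_iff₀ (by linarith)]
    linarith
  refine not_sum_log_primes_class_le (M := M) (a := ((N - 1 : ℕ) : ZMod M)) (α := 1 / (2 * M))
    (C₀ := C) ((ZMod.isUnit_iff_coprime _ _).2 hcop) ?_ hC0 fun X => ?_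
  · have h1 : 0 < M.totient := Nat.totient_pos.2 hM0
    have h2 : (M.totient : ℝ) ≤ M := by exact_mod_cast Nat.totient_le M
    have h3 : (0 : ℝ) < M.totient := by exact_mod_cast h1
    rw [one_div]
    exact inv_strictAnti₀ h3 (by linarith)
  rcases Nat.eq_zero_or_pos X with rfl | hX
  · simpa using hC0
  have h := sum_log_primes_le_of_leastPow_dvd (N := N) (M := M) (X := X) (s := 1) (c := c)
    (by omega) hM0 hX
    ((Finset.Icc 1 X).filter (fun q : ℕ => q.Prime ∧ (q : ZMod M) = ((N - 1 : ℕ) : ZMod M)))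
    (fun q hq => (Finset.mem_filter.1 hq).2.1)
    (fun q hq => (Finset.mem_Icc.1 (Finset.mem_filter.1 hq).1).2)
    (fun q hq r hr => (ZMod.natCast_eq_natCast_iff _ _ _).1
      ((Finset.mem_filter.1 hq).2.2.trans (Finset.mem_filter.1 hr).2.2.symm))
    (fun q hq => hcl q (Finset.mem_filter.1 hq).2.1 (Finset.mem_filter.1 hq).2.2)
    (by
      rw [hc, hMpow, Nat.primeFactors_prime_pow (by omega) hp, Finset.card_singleton]
      push_cast
      ring)
  refine h.trans ?_
  have h1 : 2 * (X : ℝ) / M * ((2 * Real.log N + 2 * c + 2) / y) ≤ 2 * X / M * (1 / 8) := by gcongr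
  have h2 := hC X
  have h3 : 2 * (X : ℝ) / M * (1 / 8) + 1 / (4 * M) * X = 1 / (2 * M) * X := by
    field_simp
    ring
  linarith

theorem eq_natCast_of_eq_natCast_lt {f : ℕ → ℂ} (hf1 : f 1 = 1)
    (hmul : ∀ m n : ℕ, Nat.Coprime m n → f (m * n) = f m * f n)
    (hadd : ∀ p q : ℕ, p.Prime → q.Prime → f (p - 1 + (q - 1)) = f (p - 1) + f (q - 1))
    (hlt : ∀ m, 0 < m → m < 10 ^ 6 → f m = m) (n : ℕ) (hn : 0 < n) : f n = n := by
  have hshift := eq_natCast_prime_sub_one hf1 hmul hadd hlt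
  have hsum : ∀ p q : ℕ, p.Prime → q.Prime → f (p - 1 + (q - 1)) = ((p - 1 + (q - 1) : ℕ) : ℂ) :=
    fun p q hp hq => by rw [hadd p q hp hq, hshift p hp, hshift q hq, Nat.cast_add]
  have hprime : ∀ l, l.Prime → f l = l := fun l hl => by
    have := hsum l 2 hl Nat.prime_two
    rwa [show l - 1 + (2 - 1) = l by have := hl.pos; omega] at this
  induction n using Nat.strong_induction_on with
  | _ n ih =>
  refine eq_natCast_of_prime_powers hf1 hmul n hn fun p k hp hk hd => ?_
  have hpos : 0 < p ^ k := pow_pos hp.pos k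
  rcases (Nat.le_of_dvd hn hd).lt_or_eq with h | h
  · exact ih _ h hpos
  rcases Nat.lt_or_ge (p ^ k) (10 ^ 6) with hN | hN
  · exact hlt _ hpos hN
  rcases hk.lt_or_eq with hk | rfl
  · obtain ⟨q, m, hq, hqm, hpm, ht⟩ := exists_prime_modEq_tame hp hk hN
    have hm0 : 0 < m := Nat.pos_of_ne_zero fun h0 => by simp [h0] at hqm
    have h1 := hsum q 3 hq Nat.prime_three
    rw [show q - 1 + (3 - 1) = p ^ k * m by have := hq.pos; omega,
      hmul _ _ (((hp.coprime_iff_not_dvd).2 hpm).pow_left k),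
      eq_natCast_of_tame hf1 hmul hm0 (fun j hj hjN => ih j (h ▸ hjN) hj) ht
        (fun l hl _ => hprime l hl), Nat.cast_mul] at h1
    exact mul_right_cancel₀ (by exact_mod_cast hm0.ne') h1
  · rw [pow_one]
    exact hprime p hp

/-- The product of `a, a + 1, …, a + 2 ^ k - 1`, by bisection. -/
def blockProd : ℕ → ℕ → ℕ
  | 0, a => a
  | k + 1, a => blockProd k a * blockProd k (a + 2 ^ k)

theorem dvd_blockProd {l k a : ℕ} (h1 : a ≤ l) (h2 : l < a + 2 ^ k) : l ∣ blockProd k a := by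
  induction k generalizing a with
  | zero => rw [show l = a by omega, blockProd]
  | succ k ih =>
    rw [pow_succ] at h2
    rcases Nat.lt_or_ge l (a + 2 ^ k) with h | h
    · exact (ih h1 h).mul_right _
    · exact (ih h (by omega)).mul_left _

/-- A primality test by coprimality with the products of `2, …, 2 ^ k + 1`, complete below
`2050 ^ 2`. -/
def blockTest (r : ℕ) : Bool :=
  Nat.ble 2 r && [0, 2, 4, 8, 11].any fun k =>
    Nat.blt r ((2 ^ k + 2) * (2 ^ k + 2)) && Nat.beq (Nat.gcd r (blockProd k 2)) 1

theorem prime_of_blockTest {r : ℕ} (h : blockTest r = true) : r.Prime := by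
  simp only [blockTest, Bool.and_eq_true, List.any_eq_true, Nat.ble_eq, Nat.blt_eq,
    Nat.beq_eq] at h
  obtain ⟨h2, k, -, hlt, hg⟩ := h
  by_contra hr
  have hp := Nat.minFac_prime (n := r) (by omega)
  have hsq := Nat.minFac_sq_le_self (n := r) (by omega) hr
  have hm : r.minFac < 2 + 2 ^ k := by
    rw [add_comm]
    exact Nat.mul_self_lt_mul_self_iff.1 (by rw [← sq]; exact hsq.trans_lt hlt)
  have := Nat.dvd_gcd r.minFac_dvd (dvd_blockProd hp.two_le hm)
  rw [hg] at this
  exact hp.one_lt.ne' (Nat.dvd_one.1 this)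

/-- Search for primes `q` and `r` with `(q - 1) + (r - 1) = 2 * n`, `q ≡ 1 [MOD 4]` and
`q ≤ n`. -/
def oddTest (n : ℕ) : Bool :=
  (List.range 200).any fun k => Nat.blt (4 * k + 4) n &&
    (blockTest (4 * k + 5) && blockTest (2 * n + 2 - (4 * k + 5)))

/-- Search for primes `q` and `r` with `(q - 1) + (r - 1) = n` and `q ≤ n`. -/
def evenTest (n : ℕ) : Bool :=
  (List.range 200).any fun k => Nat.blt (k + 1) n &&
    (blockTest (k + 2) && blockTest (n + 2 - (k + 2)))

theorem evenTest_two_pow {j : ℕ} (hj : j < 18) : evenTest (2 ^ (j + 2)) = true := by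
  have h : ((List.range 18).all fun j => evenTest (2 ^ (j + 2))) = true := by decide +kernel
  exact List.all_eq_true.1 h j (List.mem_range.2 hj)

theorem oddTest_pow {i j : ℕ} (hi : i < 499) (hj : j < 12) :
    10 ^ 6 ≤ (2 * i + 3) ^ (j + 2) ∨ (2 * i + 3) ^ (j + 2) = 9 ∨
      oddTest ((2 * i + 3) ^ (j + 2)) = true := by
  have h : ((List.range 499).all fun i => (List.range 12).all fun j =>
      Nat.ble (10 ^ 6) ((2 * i + 3) ^ (j + 2)) || (Nat.beq ((2 * i + 3) ^ (j + 2)) 9 ||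
        oddTest ((2 * i + 3) ^ (j + 2)))) = true := by decide +kernel
  have := List.all_eq_true.1 (List.all_eq_true.1 h i (List.mem_range.2 hi)) j (List.mem_range.2 hj)
  rwa [Bool.or_eq_true, Bool.or_eq_true, Nat.ble_eq, Nat.beq_eq] at this

theorem eq_natCast_of_lt {f : ℕ → ℂ} (hf1 : f 1 = 1)
    (hmul : ∀ m n : ℕ, Nat.Coprime m n → f (m * n) = f m * f n)
    (hadd : ∀ p q : ℕ, p.Prime → q.Prime → f (p - 1 + (q - 1)) = f (p - 1) + f (q - 1))
    (n : ℕ) (hn : 0 < n) (hlt : n < 10 ^ 6) : f n = n := by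
  have hf2 : f 2 = 2 := by
    have := hadd 2 2 Nat.prime_two Nat.prime_two
    norm_num [hf1] at this
    exact this
  induction n using Nat.strong_induction_on with
  | _ n ih =>
  refine eq_natCast_of_prime_powers hf1 hmul n hn fun p k hp hk hd => ?_
  have hpos : 0 < p ^ k := pow_pos hp.pos k
  rcases (Nat.le_of_dvd hn hd).lt_or_eq with h | h
  · exact ih _ h hpos (h.trans hlt)
  have hp2 := hp.two_le
  rcases hk.lt_or_eq with hk | rfl
  · obtain ⟨j, rfl⟩ : ∃ j, k = j + 2 := ⟨k - 2, by omega⟩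
    have hlt' : p ^ (j + 2) < 10 ^ 6 := h ▸ hlt
    have hj : j < 18 := by
      by_contra! hj
      have h1 : 2 ^ 20 ≤ 2 ^ (j + 2) := Nat.pow_le_pow_right (by norm_num) (by omega)
      have h2 : 2 ^ (j + 2) ≤ p ^ (j + 2) := Nat.pow_le_pow_left hp2 _
      norm_num at h1 hlt'
      omega
    rcases hp.eq_two_or_odd' with rfl | ho
    · have ht := evenTest_two_pow hj
      rw [h] at ht ⊢
      simp only [evenTest, List.any_eq_true, Bool.and_eq_true, Nat.blt_eq] at ht
      obtain ⟨q, -, hqn, hq, hr⟩ := ht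
      have := hadd _ _ (prime_of_blockTest hq) (prime_of_blockTest hr)
      have hr2 := (prime_of_blockTest hr).two_le
      rw [ih (q + 2 - 1) (by omega) (by omega) (by omega),
        ih (n + 2 - (q + 2) - 1) (by omega) (by omega) (by omega), ← Nat.cast_add] at this
      rwa [show q + 2 - 1 + (n + 2 - (q + 2) - 1) = n by omega] at this
    · obtain ⟨i, hi⟩ : ∃ i, p = 2 * i + 3 := by
        obtain ⟨i, rfl⟩ := ho
        exact ⟨i - 1, by omega⟩
      have hi' : i < 499 := by
        by_contra! hi'
        have h1 : p ^ 2 ≤ p ^ (j + 2) := Nat.pow_le_pow_right (by omega) (by omega)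
        nlinarith
      have hj' : j < 12 := by
        by_contra! hj
        have h1 : 3 ^ 14 ≤ 3 ^ (j + 2) := Nat.pow_le_pow_right (by norm_num) (by omega)
        have h2 : 3 ^ (j + 2) ≤ p ^ (j + 2) := Nat.pow_le_pow_left (by omega) _
        norm_num at h1 hlt'
        omega
      have hon : Odd n := h ▸ ho.pow
      have ht := oddTest_pow hi' hj'
      rw [← hi, h] at ht
      have hc2 : f (2 * n) = 2 * f n := by
        rw [hmul _ _ (Nat.coprime_two_left.2 hon), hf2]
      rw [h]
      suffices hs : f (2 * n) = ((2 * n : ℕ) : ℂ) by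
        rw [hc2, Nat.cast_mul, Nat.cast_two] at hs
        exact mul_left_cancel₀ two_ne_zero hs
      rcases ht with ht | rfl | ht
      · omega
      · have h18 := hadd 13 7 (by norm_num) (by norm_num)
        have h12 := hmul 3 4 (by norm_num)
        have h3 := ih 3 (by norm_num) (by norm_num) (by norm_num)
        have h4 := ih 4 (by norm_num) (by norm_num) (by norm_num)
        have h6 := ih 6 (by norm_num) (by norm_num) (by norm_num)
        norm_num [h3, h4, h6] at h12 h18 ⊢
        rw [h18, h12]
        norm_num
      · simp only [oddTest, List.any_eq_true, Bool.and_eq_true, Nat.blt_eq] at ht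
        obtain ⟨q, -, hqn, hq, hr⟩ := ht
        have := hadd _ _ (prime_of_blockTest hq) (prime_of_blockTest hr)
        obtain ⟨m, rfl⟩ := hon
        have hr2 := (prime_of_blockTest hr).two_le
        rw [ih (4 * q + 5 - 1) (by omega) (by omega) (by omega),
          show 2 * (2 * m + 1) + 2 - (4 * q + 5) - 1 = 2 * (2 * (m - q - 1) + 1) by omega,
          hmul _ _ (Nat.coprime_two_left.2 ⟨_, rfl⟩), hf2,
          ih (2 * (m - q - 1) + 1) (by omega) (by omega) (by omega),
          show 4 * q + 5 - 1 + 2 * (2 * (m - q - 1) + 1) = 2 * (2 * m + 1) by omega] at this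
        rw [this]
        norm_cast
        omega
  · rw [pow_one] at h ⊢
    have h1 := hadd p 2 hp Nat.prime_two
    rw [ih (p - 1) (by omega) (by omega) (by omega), show p - 1 + (2 - 1) = p by omega] at h1
    rw [h1, show 2 - 1 = 1 from rfl, hf1, Nat.cast_sub (by omega)]
    simp

theorem stmt_1 (f : ℕ → ℂ)
    (hf1 : f 1 = 1)
    (hmul : ∀ m n : ℕ, Nat.Coprime m n → f (m * n) = f m * f n)
    (heq : ∀ a b : ℕ, (∃ p : ℕ, p.Prime ∧ a = p - 1) →
      (∃ q : ℕ, q.Prime ∧ b = q - 1) → f (a + b) = f a + f b) :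
    ∀ n : ℕ, 0 < n → f n = (n : ℂ) := by
  have hadd : ∀ p q : ℕ, p.Prime → q.Prime → f (p - 1 + (q - 1)) = f (p - 1) + f (q - 1) :=
    fun p q hp hq => heq _ _ ⟨p, hp, rfl⟩ ⟨q, hq, rfl⟩
  exact eq_natCast_of_eq_natCast_lt hf1 hmul hadd (eq_natCast_of_lt hf1 hmul hadd)
end

section
/- If a multiplicative function f : ℕ → ℂ satisfies f(a+b) = f(a) + f(b) for all a, b in the set PRIMES−1 = { p − 1 : p prime }, then f satisfies f(p+q-2) = f(p) + f(q) - f(2) for all primes p and q. -/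
theorem stmt_2 (f : ℕ → ℂ)
    (hf1 : f 1 = 1)
    (hmul : ∀ m n : ℕ, Nat.Coprime m n → f (m * n) = f m * f n)
    (heq : ∀ a b : ℕ, (∃ p : ℕ, p.Prime ∧ a = p - 1) →
      (∃ q : ℕ, q.Prime ∧ b = q - 1) → f (a + b) = f a + f b) :
    ∀ p q : ℕ, p.Prime → q.Prime → f (p + q - 2) = f p + f q - f 2 := by
  have hsucc : ∀ p : ℕ, p.Prime → f p = f (p - 1) + 1 := by
    intro p hp
    have h := heq (p - 1) 1 ⟨p, hp, rfl⟩ ⟨2, Nat.prime_two, rfl⟩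
    rwa [Nat.sub_add_cancel hp.one_le, hf1] at h
  intro p q hp hq
  have hadd := heq (p - 1) (q - 1) ⟨p, hp, rfl⟩ ⟨q, hq, rfl⟩
  have hindex : p + q - 2 = (p - 1) + (q - 1) := by
    have := hp.two_le
    have := hq.two_le
    omega
  have htwo : f 2 = 1 + 1 := by simpa [hf1] using hsucc 2 Nat.prime_two
  rw [hindex, hadd, hsucc p hp, hsucc q hq, htwo]
  ring
end

section
/- If a multiplicative function f : ℕ → ℂ satisfies f(p+q-2) = f(p) + f(q) - f(2) for all primes p and q, then f(2) = 0, f(2) = 1, or f(2) = 2. -/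
theorem stmt_3 (f : ℕ → ℂ)
    (hf1 : f 1 = 1)
    (hmul : ∀ m n : ℕ, Nat.Coprime m n → f (m * n) = f m * f n)
    (heq : ∀ p q : ℕ, p.Prime → q.Prime → f (p + q - 2) = f p + f q - f 2) :
    f 2 = 0 ∨ f 2 = 1 ∨ f 2 = 2 := by
  have h4 : f 4 = f 3 + f 3 - f 2 := heq 3 3 (by norm_num) (by norm_num)
  have h6 : f 6 = f 5 + f 3 - f 2 := heq 5 3 (by norm_num) (by norm_num)
  have h8 : f 8 = f 5 + f 5 - f 2 := heq 5 5 (by norm_num) (by norm_num)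
  have h8' : f 8 = f 7 + f 3 - f 2 := heq 7 3 (by norm_num) (by norm_num)
  have h10 : f 10 = f 7 + f 5 - f 2 := heq 7 5 (by norm_num) (by norm_num)
  have h12 : f 12 = f 7 + f 7 - f 2 := heq 7 7 (by norm_num) (by norm_num)
  have m6 : f 6 = f 2 * f 3 := hmul 2 3 (by norm_num)
  have m10 : f 10 = f 2 * f 5 := hmul 2 5 (by norm_num)
  have m12 : f 12 = f 3 * f 4 := hmul 3 4 (by norm_num)
  have h5 : f 5 = f 2 * f 3 + f 2 - f 3 := by linear_combination m6 - h6
  have h7 : f 7 = 2 * f 5 - f 3 := by linear_combination h8 - h8'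
  rw [m10, h7, h5] at h10
  rw [m12, h4, h7, h5] at h12
  generalize f 2 = a at *
  generalize f 3 = b at *
  by_cases ha : a = 2
  · exact Or.inr (Or.inr ha)
  have ha' : 2 - a ≠ 0 := sub_ne_zero.mpr (Ne.symm ha)
  have hb : b = a / (2 - a) := by
    rw [eq_div_iff ha']
    apply mul_left_cancel₀ ha'
    linear_combination h10
  have key : a * a * (a - 1) = 0 := by
    rw [hb] at h12
    field_simp at h12
    linear_combination (1 / 2) * h12
  rcases mul_eq_zero.mp key with h | h
  · exact Or.inl (mul_self_eq_zero.mp h)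
  · exact Or.inr (Or.inl (sub_eq_zero.mp h))
end

section
/- If a multiplicative function f : ℕ → ℂ satisfies f(p+q-2) = f(p) + f(q) - f(2) for all primes p and q, and f(2) = 2, then f(n) = n for all integers n with 1 ≤ n ≤ 18. -/
theorem stmt_4 (f : ℕ → ℂ)
    (hf1 : f 1 = 1)
    (hmul : ∀ m n : ℕ, Nat.Coprime m n → f (m * n) = f m * f n)
    (heq : ∀ p q : ℕ, p.Prime → q.Prime → f (p + q - 2) = f p + f q - f 2)
    (hf2 : f 2 = 2) :
    ∀ n : ℕ, 1 ≤ n → n ≤ 18 → f n = (n : ℂ) := by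
  have m6 : f 6 = f 2 * f 3 := hmul 2 3 (by norm_num)
  have m10 : f 10 = f 2 * f 5 := hmul 2 5 (by norm_num)
  have m12 : f 12 = f 3 * f 4 := hmul 3 4 (by norm_num)
  have m14 : f 14 = f 2 * f 7 := hmul 2 7 (by norm_num)
  have m15 : f 15 = f 3 * f 5 := hmul 3 5 (by norm_num)
  have m18 : f 18 = f 2 * f 9 := hmul 2 9 (by norm_num)
  have m20 : f 20 = f 4 * f 5 := hmul 4 5 (by norm_num)
  have e4 : f 4 = f 3 + f 3 - f 2 := heq 3 3 (by norm_num) (by norm_num)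
  have e6 : f 6 = f 3 + f 5 - f 2 := heq 3 5 (by norm_num) (by norm_num)
  have e8 : f 8 = f 5 + f 5 - f 2 := heq 5 5 (by norm_num) (by norm_num)
  have e8' : f 8 = f 3 + f 7 - f 2 := heq 3 7 (by norm_num) (by norm_num)
  have e12 : f 12 = f 7 + f 7 - f 2 := heq 7 7 (by norm_num) (by norm_num)
  have e12' : f 12 = f 3 + f 11 - f 2 := heq 3 11 (by norm_num) (by norm_num)
  have e14 : f 14 = f 3 + f 13 - f 2 := heq 3 13 (by norm_num) (by norm_num)
  have e16 : f 16 = f 5 + f 13 - f 2 := heq 5 13 (by norm_num) (by norm_num)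
  have e18 : f 18 = f 7 + f 13 - f 2 := heq 7 13 (by norm_num) (by norm_num)
  have e18' : f 18 = f 3 + f 17 - f 2 := heq 3 17 (by norm_num) (by norm_num)
  have e20 : f 20 = f 11 + f 11 - f 2 := heq 11 11 (by norm_num) (by norm_num)
  simp only [hf2] at m6 m10 m14 m18 e4 e6 e8 e8' e12 e12' e14 e16 e18 e18' e20
  have h5 : f 5 = f 3 + 2 := by linear_combination m6 - e6
  have h7 : f 7 = f 3 + 4 := by linear_combination e8 - e8' + 2 * h5
  have h11 : f 11 = f 3 + 8 := by linear_combination e12 - e12' + 2 * h7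
  have quad12 : f 3 * (2 * f 3 - 2) = 2 * f 3 + 6 := by
    linear_combination e12 - m12 - f 3 * e4 + 2 * h7
  have quad20 : (2 * f 3 - 2) * (f 3 + 2) = 2 * f 3 + 14 := by
    linear_combination e20 - m20 + 2 * h11 - f 5 * e4 - (2 * f 3 - 2) * h5
  have h3 : f 3 = 3 := by linear_combination (quad20 - quad12) / 4
  simp only [h3] at m6 m15 e4 e14 e18' h5 h7 h11
  have h13 : f 13 = 13 := by linear_combination m14 - e14 + 2 * h7
  have h9 : f 9 = 9 := by linear_combination (e18 - m18 + h7 + h13) / 2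
  intro n hn hn'
  interval_cases n <;> push_cast
  · exact hf1
  · exact hf2
  · exact h3
  · linear_combination e4
  · linear_combination h5
  · linear_combination m6
  · linear_combination h7
  · linear_combination e8 + 2 * h5
  · exact h9
  · linear_combination m10 + 2 * h5
  · linear_combination h11
  · linear_combination e12 + 2 * h7
  · exact h13
  · linear_combination m14 + 2 * h7
  · linear_combination m15 + 3 * h5
  · linear_combination e16 + h5 + h13
  · linear_combination m18 - e18' + 2 * h9
  · linear_combination m18 + 2 * h9
end

section
/- If a multiplicative function f : ℕ → ℂ satisfies f(p+q-2) = f(p) + f(q) - f(2) for all primes p and q, and f(2) = 1, then f(n) = 1 for all integers n with 1 ≤ n ≤ 18. -/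
theorem stmt_5 (f : ℕ → ℂ)
    (hf1 : f 1 = 1)
    (hmul : ∀ m n : ℕ, Nat.Coprime m n → f (m * n) = f m * f n)
    (heq : ∀ p q : ℕ, p.Prime → q.Prime → f (p + q - 2) = f p + f q - f 2)
    (hf2 : f 2 = 1) :
    ∀ n : ℕ, 1 ≤ n → n ≤ 18 → f n = 1 := by
  have h6 : f 6 = f 2 * f 3 := hmul 2 3 (by norm_num)
  have h10 : f 10 = f 2 * f 5 := hmul 2 5 (by norm_num)
  have h12 : f 12 = f 3 * f 4 := hmul 3 4 (by norm_num)
  have h14 : f 14 = f 2 * f 7 := hmul 2 7 (by norm_num)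
  have h15 : f 15 = f 3 * f 5 := hmul 3 5 (by norm_num)
  have h18 : f 18 = f 2 * f 9 := hmul 2 9 (by norm_num)
  have e33 : f 4 = f 3 + f 3 - f 2 := heq 3 3 (by norm_num) (by norm_num)
  have e35 : f 6 = f 3 + f 5 - f 2 := heq 3 5 (by norm_num) (by norm_num)
  have e37 : f 8 = f 3 + f 7 - f 2 := heq 3 7 (by norm_num) (by norm_num)
  have e55 : f 8 = f 5 + f 5 - f 2 := heq 5 5 (by norm_num) (by norm_num)
  have e57 : f 10 = f 5 + f 7 - f 2 := heq 5 7 (by norm_num) (by norm_num)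
  have e311 : f 12 = f 3 + f 11 - f 2 := heq 3 11 (by norm_num) (by norm_num)
  have e313 : f 14 = f 3 + f 13 - f 2 := heq 3 13 (by norm_num) (by norm_num)
  have e513 : f 16 = f 5 + f 13 - f 2 := heq 5 13 (by norm_num) (by norm_num)
  have e713 : f 18 = f 7 + f 13 - f 2 := heq 7 13 (by norm_num) (by norm_num)
  have e317 : f 18 = f 3 + f 17 - f 2 := heq 3 17 (by norm_num) (by norm_num)
  rw [hf2] at h6 h10 h14 h18 e33 e35 e37 e55 e57 e311 e313 e513 e713 e317
  have f5 : f 5 = 1 := by linear_combination h6 - e35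
  have f7 : f 7 = 1 := by linear_combination h10 - e57
  have f3 : f 3 = 1 := by linear_combination e55 - e37 + 2 * f5 - f7
  have f4 : f 4 = 1 := by linear_combination e33 + 2 * f3
  rw [f3, f4] at h12
  have f11 : f 11 = 1 := by linear_combination h12 - e311 - f3
  have f13 : f 13 = 1 := by linear_combination h14 - e313 - f3 + f7
  have f18 : f 18 = 1 := by linear_combination e713 + f7 + f13
  have f17 : f 17 = 1 := by linear_combination f18 - e317 - f3
  have f9 : f 9 = 1 := by linear_combination f18 - h18
  intro n hn hn'
  interval_cases n <;> simp_all
end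

section
/- If a multiplicative function f : ℕ → ℂ satisfies f(p+q-2) = f(p) + f(q) - f(2) for all primes p and q, and f(2) = 0, then f(n) = 0 for all integers n with 2 ≤ n ≤ 18 and n ≠ 9. -/
theorem stmt_6 (f : ℕ → ℂ)
    (hf1 : f 1 = 1)
    (hmul : ∀ m n : ℕ, Nat.Coprime m n → f (m * n) = f m * f n)
    (heq : ∀ p q : ℕ, p.Prime → q.Prime → f (p + q - 2) = f p + f q - f 2)
    (hf2 : f 2 = 0) :
    ∀ n : ℕ, 2 ≤ n → n ≤ 18 → n ≠ 9 → f n = 0 := by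
  have hadd : ∀ p q : ℕ, p.Prime → q.Prime → f (p + q - 2) = f p + f q := fun p q hp hq => by
    rw [heq p q hp hq, hf2, sub_zero]
  have htwo : ∀ m : ℕ, Nat.Coprime 2 m → f (2 * m) = 0 := fun m hm => by
    rw [hmul 2 m hm, hf2, zero_mul]
  have h6 : f 6 = 0 := htwo 3 (by norm_num)
  have h10 : f 10 = 0 := htwo 5 (by norm_num)
  have h14 : f 14 = 0 := htwo 7 (by norm_num)
  have h18 : f 18 = 0 := htwo 9 (by norm_num)
  have e33 : f 4 = f 3 + f 3 := hadd 3 3 (by norm_num) (by norm_num)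
  have e35 : f 6 = f 3 + f 5 := hadd 3 5 (by norm_num) (by norm_num)
  have e55 : f 8 = f 5 + f 5 := hadd 5 5 (by norm_num) (by norm_num)
  have e37 : f 8 = f 3 + f 7 := hadd 3 7 (by norm_num) (by norm_num)
  have e57 : f 10 = f 5 + f 7 := hadd 5 7 (by norm_num) (by norm_num)
  have h3 : f 3 = 0 := by
    linear_combination (-1 / 4) * h10 + (3 / 4) * h6 + (1 / 4) * e57 - (3 / 4) * e35
      + (1 / 4) * e55 - (1 / 4) * e37
  have h5 : f 5 = 0 := by linear_combination h6 - e35 - h3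
  have h4 : f 4 = 0 := by rw [e33, h3, add_zero]
  have h8 : f 8 = 0 := by rw [e55, h5, add_zero]
  have h7 : f 7 = 0 := by linear_combination h8 - e37 - h3
  have h12 : f 12 = 0 := by
    rw [show f 12 = f 3 * f 4 from hmul 3 4 (by norm_num), h3, zero_mul]
  have h15 : f 15 = 0 := by
    rw [show f 15 = f 3 * f 5 from hmul 3 5 (by norm_num), h3, zero_mul]
  have e311 : f 12 = f 3 + f 11 := hadd 3 11 (by norm_num) (by norm_num)
  have e313 : f 14 = f 3 + f 13 := hadd 3 13 (by norm_num) (by norm_num)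
  have e513 : f 16 = f 5 + f 13 := hadd 5 13 (by norm_num) (by norm_num)
  have e317 : f 18 = f 3 + f 17 := hadd 3 17 (by norm_num) (by norm_num)
  have h11 : f 11 = 0 := by linear_combination h12 - e311 - h3
  have h13 : f 13 = 0 := by linear_combination h14 - e313 - h3
  have h16 : f 16 = 0 := by rw [e513, h5, h13, add_zero]
  have h17 : f 17 = 0 := by linear_combination h18 - e317 - h3
  intro n hn2 hn18 hn9
  interval_cases n <;> first | assumption | exact absurd rfl hn9
end

section
/- Let f : ℕ → ℂ be a multiplicative function satisfying f(p+q-2) = f(p) + f(q) - f(2) for all primes p and q, with f(2) = 2. If N ≥ 20 is an integer such that every even number 2m with 4 ≤ 2m ≤ 2N can be written as a sum of two primes, then f(n) = n for all positive integers n ≤ N − 2. -/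
/-- The values of `f` forced by the functional equation at small primes. -/
theorem small_values_of_prime_add_sub_two (f : ℕ → ℂ) (hf1 : f 1 = 1)
    (hmul : ∀ m n : ℕ, Nat.Coprime m n → f (m * n) = f m * f n)
    (heq : ∀ p q : ℕ, p.Prime → q.Prime → f (p + q - 2) = f p + f q - f 2)
    (hf2 : f 2 = 2) :
    (∀ k < 9, 1 ≤ k → f k = (k : ℂ)) ∧ f 13 = 13 := by
  have h4 : f 4 = f 3 + f 3 - f 2 := heq 3 3 (by norm_num) (by norm_num)
  have h6 : f 6 = f 3 + f 5 - f 2 := heq 3 5 (by norm_num) (by norm_num)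
  have h8 : f 8 = f 5 + f 5 - f 2 := heq 5 5 (by norm_num) (by norm_num)
  have h8' : f 8 = f 3 + f 7 - f 2 := heq 3 7 (by norm_num) (by norm_num)
  have h12 : f 12 = f 7 + f 7 - f 2 := heq 7 7 (by norm_num) (by norm_num)
  have h14 : f 14 = f 3 + f 13 - f 2 := heq 3 13 (by norm_num) (by norm_num)
  have h14' : f 14 = f 5 + f 11 - f 2 := heq 5 11 (by norm_num) (by norm_num)
  have h20 : f 20 = f 11 + f 11 - f 2 := heq 11 11 (by norm_num) (by norm_num)
  have m6 : f 6 = f 2 * f 3 := hmul 2 3 (by norm_num)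
  have m12 : f 12 = f 3 * f 4 := hmul 3 4 (by norm_num)
  have m14 : f 14 = f 2 * f 7 := hmul 2 7 (by norm_num)
  have m20 : f 20 = f 4 * f 5 := hmul 4 5 (by norm_num)
  rw [hf2] at h4 h6 h8 h8' h12 h14 h14' h20 m6 m14
  have e5 : f 5 = f 3 + 2 := by linear_combination m6 - h6
  have e7 : f 7 = f 3 + 4 := by linear_combination h8 - h8' + 2 * e5
  have e11 : f 11 = f 3 + 8 := by linear_combination m14 - h14' - e5 + 2 * e7
  have q12 : f 3 * (2 * f 3 - 2) = 2 * f 3 + 6 := by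
    linear_combination h12 - m12 - f 3 * h4 + 2 * e7
  have q20 : (2 * f 3 - 2) * (f 3 + 2) = 2 * f 3 + 14 := by
    linear_combination h20 - m20 - f 5 * h4 - (2 * f 3 - 2) * e5 + 2 * e11
  have e3 : f 3 = 3 := by linear_combination (q20 - q12) / 4
  rw [e3] at h4 h14 m6 e5 e7
  have e13 : f 13 = 13 := by linear_combination m14 - h14 + 2 * e7
  refine ⟨fun k hk hk1 => ?_, e13⟩
  interval_cases k <;> push_cast
  · exact hf1
  · exact hf2
  · exact e3
  · linear_combination h4
  · linear_combination e5
  · linear_combination m6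
  · linear_combination e7
  · linear_combination h8 + 2 * e5

/-- If `f` is the identity below `n`, it is the identity on products of two coprime numbers
below `n`. -/
theorem eq_natCast_of_coprime_mul {f : ℕ → ℂ}
    (hmul : ∀ m n : ℕ, Nat.Coprime m n → f (m * n) = f m * f n) {n : ℕ}
    (ih : ∀ k < n, 1 ≤ k → f k = (k : ℂ)) {a b t : ℕ} (hab : Nat.Coprime a b)
    (ha : a < n) (hb : b < n) (ha1 : 1 ≤ a) (hb1 : 1 ≤ b) (ht : t = a * b) :
    f t = (t : ℂ) := by
  rw [ht, hmul a b hab, ih a ha ha1, ih b hb hb1, Nat.cast_mul]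

/-- If `f` is the identity below `n`, it is the identity at every positive multiple `t` of `2 ^ c`
with `t < 2 ^ c * n` and `t < 3 * n`, unless `t` is a power of two: such a `t` is the product of
its two-part and its odd part, both below `n`. -/
theorem eq_natCast_or_eq_two_pow {f : ℕ → ℂ}
    (hmul : ∀ m n : ℕ, Nat.Coprime m n → f (m * n) = f m * f n) {n : ℕ}
    (ih : ∀ k < n, 1 ≤ k → f k = (k : ℂ)) {t c : ℕ} (ht1 : 1 ≤ t) (hc : 2 ^ c ∣ t)
    (htc : t < 2 ^ c * n) (ht3 : t < 3 * n) :
    f t = (t : ℂ) ∨ ∃ a, t = 2 ^ a := by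
  obtain ⟨a, m, hm, rfl⟩ := Nat.exists_eq_two_pow_mul_odd (n := t) (by omega)
  by_cases hm1 : m = 1
  · exact Or.inr ⟨a, by rw [hm1, mul_one]⟩
  left
  have hm3 : 3 ≤ m := by
    obtain ⟨j, rfl⟩ := hm
    omega
  have hcop : Nat.Coprime (2 ^ a) m := (Nat.coprime_two_left.mpr hm).pow_left a
  have hca : 2 ^ c ∣ 2 ^ a :=
    ((Nat.coprime_two_left.mpr hm).pow_left c).dvd_of_dvd_mul_right hc
  have hle : 2 ^ c ≤ 2 ^ a := Nat.le_of_dvd (by positivity) hca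
  refine eq_natCast_of_coprime_mul hmul ih hcop ?_ ?_ Nat.one_le_two_pow (by omega) rfl
  · nlinarith [Nat.mul_le_mul_left (2 ^ a) hm3]
  · have h1 : 2 ^ c * m < 2 ^ c * n := (Nat.mul_le_mul_right m hle).trans_lt htc
    exact lt_of_mul_lt_mul_left h1 (by positivity)

/-- If `f` is the identity below an odd `n ≥ 9`, it is the identity at the odd primes
below `2 * n`. -/
theorem eq_natCast_of_prime_lt_two_mul {f : ℕ → ℂ}
    (hmul : ∀ m n : ℕ, Nat.Coprime m n → f (m * n) = f m * f n)
    (heq : ∀ p q : ℕ, p.Prime → q.Prime → f (p + q - 2) = f p + f q - f 2)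
    (h13 : f 13 = 13) {n : ℕ} (hn : 9 ≤ n) (hodd : Odd n)
    (ih : ∀ k < n, 1 ≤ k → f k = (k : ℂ)) {r : ℕ} (hr : r.Prime) (hr2 : Odd r)
    (hrn : r < 2 * n) : f r = (r : ℂ) := by
  have h2 : f 2 = 2 := by simpa using ih 2 (by omega) (by omega)
  have h3 : f 3 = 3 := by simpa using ih 3 (by omega) (by omega)
  have h5 : f 5 = 5 := by simpa using ih 5 (by omega) (by omega)
  have h7 : f 7 = 7 := by simpa using ih 7 (by omega) (by omega)
  by_cases hlt : r < n
  · exact ih r hlt hr.one_le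
  obtain ⟨i, hi⟩ := hodd
  obtain ⟨j, hj⟩ := hr2
  by_cases hlast : r + 1 = 2 * n
  · rcases eq_natCast_or_eq_two_pow hmul ih (t := r + 3) (c := 2) (by omega) (by omega)
      (by omega) (by omega) with h | ⟨a, ha⟩
    · have e := heq r 5 hr (by norm_num)
      rw [show r + 5 - 2 = r + 3 by omega, h, h5, h2] at e
      push_cast at e
      linear_combination -e
    · have ha4 : 4 < a := by
        by_contra! hle
        have := Nat.pow_le_pow_right (n := 2) (by norm_num) hle
        omega
      obtain ⟨d, rfl⟩ := Nat.exists_eq_add_of_lt ha4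
      have hd : 2 ^ (4 + d + 1) = 32 * 2 ^ d := by ring
      rw [hd] at ha
      have h : f (r + 11) = ((r + 11 : ℕ) : ℂ) :=
        eq_natCast_of_coprime_mul hmul ih (a := 2 ^ 3) (b := 4 * 2 ^ d + 1)
          (Nat.Coprime.pow_left 3 (Nat.coprime_two_left.mpr ⟨2 * 2 ^ d, by ring⟩))
          (by omega) (by omega) (by omega) (by omega) (by omega)
      have e := heq r 13 hr (by norm_num)
      rw [show r + 13 - 2 = r + 11 by omega, h, h13, h2] at e
      push_cast at e
      linear_combination -e
  · rcases eq_natCast_or_eq_two_pow hmul ih (t := r + 1) (c := 1) (by omega) (by omega)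
      (by omega) (by omega) with h | ⟨a, ha⟩
    · have e := heq r 3 hr (by norm_num)
      rw [show r + 3 - 2 = r + 1 by omega, h, h3, h2] at e
      push_cast at e
      linear_combination -e
    · have ha3 : 3 < a := by
        by_contra! hle
        have := Nat.pow_le_pow_right (n := 2) (by norm_num) hle
        omega
      obtain ⟨d, rfl⟩ := Nat.exists_eq_add_of_lt ha3
      have hd : 2 ^ (3 + d + 1) = 16 * 2 ^ d := by ring
      rw [hd] at ha
      have h : f (r + 5) = ((r + 5 : ℕ) : ℂ) :=
        eq_natCast_of_coprime_mul hmul ih (a := 2 ^ 2) (b := 4 * 2 ^ d + 1)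
          (Nat.Coprime.pow_left 2 (Nat.coprime_two_left.mpr ⟨2 * 2 ^ d, by ring⟩))
          (by omega) (by omega) (by omega) (by omega) (by omega)
      have e := heq r 7 hr (by norm_num)
      rw [show r + 7 - 2 = r + 5 by omega, h, h7, h2] at e
      push_cast at e
      linear_combination -e

theorem stmt_8 (f : ℕ → ℂ)
    (hf1 : f 1 = 1)
    (hmul : ∀ m n : ℕ, Nat.Coprime m n → f (m * n) = f m * f n)
    (heq : ∀ p q : ℕ, p.Prime → q.Prime → f (p + q - 2) = f p + f q - f 2)
    (hf2 : f 2 = 2)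
    (N : ℕ) (hN : 20 ≤ N)
    (hGoldbach : ∀ m : ℕ, 2 ≤ m → m ≤ N →
      ∃ p q : ℕ, p.Prime ∧ q.Prime ∧ 2 * m = p + q) :
    ∀ n : ℕ, 1 ≤ n → n ≤ N - 2 → f n = (n : ℂ) := by
  obtain ⟨hsmall, h13⟩ := small_values_of_prime_add_sub_two f hf1 hmul heq hf2
  intro n
  induction n using Nat.strong_induction_on with
  | _ n ih' =>
  intro hn1 hnN
  by_cases hn : n < 9
  · exact hsmall n hn hn1
  have ih : ∀ k < n, 1 ≤ k → f k = (k : ℂ) := fun k hk hk1 => ih' k hk hk1 (by omega)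
  rcases Nat.even_or_odd' n with ⟨m, hm | hm⟩
  · obtain ⟨p, q, hp, hq, hpq⟩ := hGoldbach (m + 1) (by omega) (by omega)
    have hp' := hp.eq_two_or_odd
    have hq' := hq.eq_two_or_odd
    have hp2 := hp.two_le
    have hq2 := hq.two_le
    have hne : ∀ r : ℕ, r.Prime → r ≠ n := by
      intro r hr hrn
      have := hr.eq_two_or_odd
      omega
    have hpn := hne p hp
    have hqn := hne q hq
    have e := heq p q hp hq
    rw [ih p (by omega) (by omega), ih q (by omega) (by omega), hf2,
      show p + q - 2 = n by omega] at e
    have hc : (p : ℂ) + q = n + 2 := by exact_mod_cast (show p + q = n + 2 by omega)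
    linear_combination e + hc
  · have hodd : Odd n := ⟨m, hm⟩
    obtain ⟨p, q, hp, hq, hpq⟩ := hGoldbach (n + 1) (by omega) (by omega)
    have hp' := hp.eq_two_or_odd
    have hq' := hq.eq_two_or_odd
    have hp2 := hp.two_le
    have hq2 := hq.two_le
    have hne : ∀ r : ℕ, r.Prime → r ≠ 2 * n := by
      intro r hr hrn
      have := hr.eq_two_or_odd
      omega
    have hpn := hne p hp
    have hqn := hne q hq
    have e := heq p q hp hq
    rw [eq_natCast_of_prime_lt_two_mul hmul heq h13 (by omega) hodd ih hp
        (Nat.odd_iff.mpr (by omega)) (by omega),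
      eq_natCast_of_prime_lt_two_mul hmul heq h13 (by omega) hodd ih hq
        (Nat.odd_iff.mpr (by omega)) (by omega), hf2,
      show p + q - 2 = 2 * n by omega, hmul 2 n (Nat.coprime_two_left.mpr hodd), hf2] at e
    have hc : (p : ℂ) + q = 2 * n + 2 := by exact_mod_cast (show p + q = 2 * n + 2 by omega)
    linear_combination (e + hc) / 2
end

section
/- Let H be the set of positive integers n such that for every prime p > 1000 the p-adic valuation v_p(n) is at most 1, and for every prime p < 1000 the p-adic valuation v_p(n) is at most ⌊9·log 10 / log p⌋ − 1. Then for any integer m > 10^10 there exists an odd prime q ≤ m − 1 such that m + q ∈ H. -/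
/-- The Spiro set `H`: positive integers whose `p`-adic valuation is at most `1`
for primes `p > 1000` and at most `⌊9 log 10 / log p⌋ - 1` for primes `p < 1000`. -/
def SpiroH : Set ℕ :=
  {n | 0 < n ∧ ∀ p : ℕ, p.Prime →
    (1000 < p → padicValNat p n ≤ 1) ∧
    (p < 1000 → (padicValNat p n : ℤ) ≤ ⌊(9 : ℝ) * Real.log 10 / Real.log p⌋ - 1)}

/-- The part of `N!` coprime to the prime `p` divides the product of `N` consecutive terms of an
arithmetic progression with common difference `p ^ k`. -/
lemma ordCompl_factorial_dvd_prod_arith {p : ℕ} (hp : p.Prime) (k N : ℕ) (a : ℤ) :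
    ((ordCompl[p] N.factorial : ℕ) : ℤ) ∣ ∏ i ∈ Finset.range N, (a + (p : ℤ) ^ k * i) := by
  set M := ordCompl[p] N.factorial with hM
  have hcop : Nat.Coprime (p ^ k) M :=
    (Nat.coprime_ordCompl hp N.factorial_ne_zero).pow_left k
  obtain ⟨u, v, huv⟩ : IsCoprime ((p : ℤ) ^ k) (M : ℤ) := by
    exact_mod_cast Nat.isCoprime_iff_coprime.2 hcop
  have hMN : (M : ℤ) ∣ (N.factorial : ℤ) := by
    exact_mod_cast Nat.ordCompl_dvd N.factorial p
  have hdvd : (M : ℤ) ∣ ∏ i ∈ Finset.range N, (a * u + i) :=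
    hMN.trans (Nat.factorial_coe_dvd_prod N (a * u))
  have hmod : ∏ i ∈ Finset.range N, (a + (p : ℤ) ^ k * i) ≡
      ∏ i ∈ Finset.range N, ((p : ℤ) ^ k * (a * u + i)) [ZMOD M] := by
    refine Int.ModEq.prod fun i _ => ?_
    refine Int.modEq_iff_dvd.2 ⟨-(a * v), ?_⟩
    linear_combination a * huv
  refine (Int.modEq_zero_iff_dvd).1 (hmod.trans ?_)
  rw [Finset.prod_mul_distrib]
  exact Int.modEq_zero_iff_dvd.2 (hdvd.mul_left _)

/-- A Chebyshev-type upper bound for the product of the primes `q < m` with `q ≡ -m` modulo a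
prime power. -/
lemma prod_primes_modEq_neg_le {p k : ℕ} (hp : p.Prime) (hk : k ≠ 0) (m : ℕ) :
    ∏ q ∈ Finset.Ioo (m / p ^ k + 1) m with q.Prime ∧ p ^ k ∣ m + q, q ≤
      (p * p ^ k) ^ (m / p ^ k + 1) := by
  set d := p ^ k with hd
  set K := m / d with hK
  set N := K + 1 with hN
  set Q := {q ∈ Finset.Ioo N m | q.Prime ∧ d ∣ m + q} with hQ
  have hdpos : 0 < d := pow_pos hp.pos k
  by_cases hpm : p ∣ m
  · have hsub : Q ⊆ {p} := by
      intro q hq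
      simp only [hQ, Finset.mem_filter] at hq
      have hpq : p ∣ q := (Nat.dvd_add_right hpm).1 ((dvd_pow_self p hk).trans hq.2.2)
      simpa using ((Nat.prime_dvd_prime_iff_eq hp hq.2.1).1 hpq).symm
    calc ∏ q ∈ Q, q ≤ ∏ q ∈ {p}, q :=
          Finset.prod_le_prod_of_subset_of_one_le' hsub fun q hq _ => by
            simp only [Finset.mem_singleton] at hq
            exact hq ▸ hp.one_le
      _ = p := by simp
      _ ≤ p * d := Nat.le_mul_of_pos_right p hdpos
      _ ≤ (p * d) ^ N := Nat.le_self_pow K.succ_ne_zero _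
  · have hlt : m < d * N := by
      have := Nat.lt_mul_div_succ m hdpos
      simpa [hN, hK] using this
    have hle : d * K ≤ m := Nat.mul_div_le m d
    set P := ∏ i ∈ Finset.range N, (d * N - m + d * i) with hP
    have hPpos : 0 < P := Finset.prod_pos fun i _ => by omega
    have hPle : P ≤ d ^ N * N.factorial := by
      rw [← Finset.prod_range_add_one_eq_factorial, ← Finset.card_range N, ← Finset.prod_const,
        Finset.card_range, ← Finset.prod_mul_distrib]
      refine Finset.prod_le_prod' fun i _ => ?_
      have : d * N = d * K + d := by rw [hN]; ring
      have : d * (i + 1) = d * i + d := by ring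
      omega
    set M := ordCompl[p] N.factorial with hM
    have hMP : M ∣ P := by
      have := ordCompl_factorial_dvd_prod_arith hp k N ((d * N - m : ℕ) : ℤ)
      rw [hP]
      zify
      convert this using 3
      simp [hd]
    have hQP : ∏ q ∈ Q, q ∣ P := by
      refine Finset.prod_primes_dvd _ (fun q hq => ?_) (fun q hq => ?_)
      · exact (Finset.mem_filter.1 hq).2.1.prime
      · simp only [hQ, Finset.mem_filter, Finset.mem_Ioo] at hq
        obtain ⟨⟨_, hqm⟩, hqp, c, hc⟩ := hq
        have hNc : N ≤ c := by
          by_contra! h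
          have : d * c ≤ d * K := Nat.mul_le_mul_left d (by omega)
          have := hqp.pos
          omega
        have hcN : c < N + N := by
          by_contra! h
          have : d * (N + N) ≤ d * c := Nat.mul_le_mul_left d h
          have : d * (N + N) = d * N + d * N := by ring
          omega
        have hterm : q = d * N - m + d * (c - N) := by
          obtain ⟨e, rfl⟩ := Nat.exists_eq_add_of_le hNc
          have : d * (N + e) = d * N + d * e := by ring
          simp only [Nat.add_sub_cancel_left]
          omega
        conv_lhs => rw [hterm]
        exact Finset.dvd_prod_of_mem (fun i => d * N - m + d * i)
          (Finset.mem_range.2 (by omega))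
    have hcop : Nat.Coprime M (∏ q ∈ Q, q) := by
      refine Nat.Coprime.prod_right fun q hq => ?_
      simp only [hQ, Finset.mem_filter, Finset.mem_Ioo] at hq
      refine Nat.Coprime.coprime_dvd_left (Nat.ordCompl_dvd N.factorial p) ?_
      exact (hq.2.1.coprime_factorial_of_lt hq.1.1).symm
    have hMQ : M * ∏ q ∈ Q, q ≤ P :=
      Nat.le_of_dvd hPpos (hcop.mul_dvd_of_dvd_of_dvd hMP hQP)
    have hfac : N.factorial ≤ p ^ N * M := by
      conv_lhs => rw [← Nat.ordProj_mul_ordCompl_eq_self N.factorial p]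
      refine Nat.mul_le_mul_right _ (Nat.pow_le_pow_right hp.pos ?_)
      have : Fact p.Prime := ⟨hp⟩
      rw [Nat.factorization_def _ hp]
      exact padicValNat_factorial_le p N
    refine Nat.le_of_mul_le_mul_left ?_ N.factorial_pos
    calc N.factorial * ∏ q ∈ Q, q ≤ p ^ N * M * ∏ q ∈ Q, q := Nat.mul_le_mul_right _ hfac
      _ = p ^ N * (M * ∏ q ∈ Q, q) := mul_assoc _ _ _
      _ ≤ p ^ N * (d ^ N * N.factorial) := Nat.mul_le_mul_left _ (hMQ.trans hPle)
      _ = N.factorial * (p * d) ^ N := by rw [mul_pow]; ring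

lemma sum_log_primes_modEq_neg_le {p k : ℕ} (hp : p.Prime) (hk : k ≠ 0) {m L : ℕ}
    (hL : m / p ^ k + 1 ≤ L) :
    ∑ q ∈ Finset.Ioo L m with q.Prime ∧ p ^ k ∣ m + q, Real.log q ≤
      ((m : ℝ) / (p : ℝ) ^ k + 1) * ((k + 1) * Real.log p) := by
  have hp1 : (1 : ℝ) ≤ p := by exact_mod_cast hp.one_le
  have hlog : 0 ≤ Real.log p := Real.log_nonneg hp1
  calc ∑ q ∈ Finset.Ioo L m with q.Prime ∧ p ^ k ∣ m + q, Real.log q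
      ≤ ∑ q ∈ Finset.Ioo (m / p ^ k + 1) m with q.Prime ∧ p ^ k ∣ m + q, Real.log q := by
        refine Finset.sum_le_sum_of_subset_of_nonneg
          (Finset.filter_subset_filter _ (Finset.Ioo_subset_Ioo_left hL))
          fun q _ _ => Real.log_natCast_nonneg q
    _ = Real.log ((∏ q ∈ Finset.Ioo (m / p ^ k + 1) m with q.Prime ∧ p ^ k ∣ m + q, q : ℕ)) := by
        rw [Nat.cast_prod, Real.log_prod]
        intro q hq
        exact_mod_cast (Finset.mem_filter.1 hq).2.1.ne_zero
    _ ≤ Real.log (((p * p ^ k) ^ (m / p ^ k + 1) : ℕ)) := by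
        refine Real.log_le_log ?_ (by exact_mod_cast prod_primes_modEq_neg_le hp hk m)
        exact Nat.cast_pos.2 (Finset.prod_pos fun q hq => (Finset.mem_filter.1 hq).2.1.pos)
    _ = ((m / p ^ k : ℕ) + 1 : ℝ) * ((k + 1) * Real.log p) := by
        rw [← pow_succ']
        push_cast
        rw [Real.log_pow, Real.log_pow]
        push_cast
        ring
    _ ≤ _ := by
        gcongr
        exact_mod_cast Nat.cast_div_le (α := ℝ) (m := m) (n := p ^ k)

lemma Real.log_le_two_mul_sqrt {x : ℝ} (hx : 0 < x) : Real.log x ≤ 2 * √x := by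
  have h := Real.log_le_sub_one_of_pos (Real.sqrt_pos.2 hx)
  rw [Real.log_sqrt hx.le] at h
  linarith

lemma sum_Ioc_inv_mul_sqrt_le {a b : ℕ} (ha : 0 < a) (hab : a ≤ b) :
    ∑ n ∈ Finset.Ioc a b, 1 / ((n : ℝ) * √n) ≤ 2 / √a - 2 / √b := by
  induction b, hab using Nat.le_induction with
  | base => simp
  | succ b hab ih =>
    rw [Finset.sum_Ioc_succ_top (by omega)]
    have hb : (0 : ℝ) < b := by exact_mod_cast (by omega : 0 < b)
    have key : 1 / (((b + 1 : ℕ) : ℝ) * √((b + 1 : ℕ) : ℝ)) ≤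
        2 / √b - 2 / √((b + 1 : ℕ) : ℝ) := by
      push_cast
      set s := √(b : ℝ) with hs
      set t := √((b : ℝ) + 1) with ht
      have hs0 : 0 < s := Real.sqrt_pos.2 hb
      have hst : s ≤ t := Real.sqrt_le_sqrt (by linarith)
      have hs2 : s ^ 2 = b := Real.sq_sqrt hb.le
      have ht2 : t ^ 2 = (b : ℝ) + 1 := Real.sq_sqrt (by linarith)
      have ht0 : 0 < t := hs0.trans_le hst
      rw [← ht2, div_sub_div _ _ hs0.ne' ht0.ne', div_le_div_iff₀ (by positivity) (by positivity)]
      have h1 : (t - s) * (t + s) = 1 := by linear_combination ht2 - hs2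
      have h2 : s ≤ 2 * (t - s) * t ^ 2 := by
        nlinarith [mul_nonneg (sub_nonneg.2 hst) (mul_nonneg ht0.le (sub_nonneg.2 hst))]
      nlinarith [mul_le_mul_of_nonneg_right h2 ht0.le]
    linarith

/-- The exponent at which the prime `p` obstructs membership in `SpiroH`. -/
def spiroExponent (p : ℕ) : ℕ := if p < 1000 then Nat.log p (10 ^ 9) else 2

lemma spiroExponent_ne_zero {p : ℕ} (hp : p.Prime) : spiroExponent p ≠ 0 := by
  unfold spiroExponent
  split_ifs with h
  · exact (Nat.log_pos hp.one_lt (by omega)).ne'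
  · norm_num

lemma million_le_pow_spiroExponent {p : ℕ} (hp : p.Prime) : 10 ^ 6 ≤ p ^ spiroExponent p := by
  unfold spiroExponent
  split_ifs with h
  · have h1 := Nat.lt_pow_succ_log_self hp.one_lt (10 ^ 9)
    rw [pow_succ p] at h1
    by_contra! h2
    have h3 := Nat.mul_lt_mul'' h2 h
    omega
  · nlinarith

lemma exists_pow_spiroExponent_dvd {n : ℕ} (hn : 0 < n) (h : n ∉ SpiroH) :
    ∃ p : ℕ, p.Prime ∧ p ^ spiroExponent p ∣ n := by
  by_contra! hcon
  refine h ⟨hn, fun p hp => ?_⟩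
  have : Fact p.Prime := ⟨hp⟩
  have hv := hcon p hp
  rw [padicValNat_dvd_iff_le hn.ne', not_le, spiroExponent] at hv
  refine ⟨fun hlt => ?_, fun hlt => ?_⟩
  · rw [if_neg (by omega)] at hv
    omega
  · rw [if_pos hlt] at hv
    have hfl : ((Nat.log p (10 ^ 9) : ℕ) : ℤ) ≤ ⌊(9 : ℝ) * Real.log 10 / Real.log p⌋ := by
      rw [Int.le_floor, le_div_iff₀ (Real.log_pos (by exact_mod_cast hp.one_lt))]
      have hpow : ((p : ℝ)) ^ Nat.log p (10 ^ 9) ≤ 10 ^ 9 := by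
        exact_mod_cast Nat.pow_log_le_self p (by norm_num : 10 ^ 9 ≠ 0)
      have hlog := Real.log_le_log (pow_pos (by exact_mod_cast hp.pos) _) hpow
      rw [Real.log_pow, Real.log_pow] at hlog
      exact_mod_cast hlog
    omega

lemma sum_log_small_prime_le {p m L : ℕ} (hp : p.Prime) (hlt : p < 1000)
    (hL : m / 10 ^ 6 + 1 ≤ L) :
    ∑ q ∈ Finset.Ioo L m with q.Prime ∧ p ^ spiroExponent p ∣ m + q, Real.log q ≤
      28 * ((m : ℝ) / 10 ^ 6 + 1) := by
  have hmil := million_le_pow_spiroExponent hp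
  refine (sum_log_primes_modEq_neg_le hp (spiroExponent_ne_zero hp)
    ((Nat.add_le_add_right (Nat.div_le_div_left hmil (by norm_num)) 1).trans hL)).trans ?_
  have hp0 : (0 : ℝ) < p := by exact_mod_cast hp.pos
  have hlog : ((spiroExponent p : ℝ) + 1) * Real.log p ≤ 28 := by
    have hpow : p ^ (spiroExponent p + 1) ≤ 2 ^ 40 := by
      rw [pow_succ, spiroExponent, if_pos hlt]
      have := Nat.pow_log_le_self p (by norm_num : 10 ^ 9 ≠ 0)
      calc p ^ Nat.log p (10 ^ 9) * p ≤ 10 ^ 9 * 1000 := Nat.mul_le_mul this hlt.le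
        _ ≤ 2 ^ 40 := by norm_num
    have h := Real.log_le_log (pow_pos hp0 (spiroExponent p + 1))
      (by exact_mod_cast hpow : (p : ℝ) ^ (spiroExponent p + 1) ≤ 2 ^ 40)
    rw [Real.log_pow, Real.log_pow] at h
    push_cast at h
    linarith [Real.log_two_lt_d9]
  have hdiv : (m : ℝ) / (p : ℝ) ^ spiroExponent p ≤ m / 10 ^ 6 :=
    div_le_div_of_nonneg_left (by positivity) (by norm_num) (by exact_mod_cast hmil)
  have : 0 ≤ (m : ℝ) / 10 ^ 6 + 1 := by positivity
  calc _ ≤ ((m : ℝ) / 10 ^ 6 + 1) * (((spiroExponent p : ℝ) + 1) * Real.log p) := by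
        have : 0 ≤ Real.log p := Real.log_natCast_nonneg p
        gcongr
    _ ≤ _ := by nlinarith

lemma sum_log_large_prime_le {p m L R : ℕ} (hp : p.Prime) (hlt : 1000 < p) (hR : p ≤ R)
    (hL : m / 10 ^ 6 + 1 ≤ L) :
    ∑ q ∈ Finset.Ioo L m with q.Prime ∧ p ^ spiroExponent p ∣ m + q, Real.log q ≤
      6 * m * (1 / ((p : ℝ) * √p)) + 6 * √R := by
  have hmil := million_le_pow_spiroExponent hp
  refine (sum_log_primes_modEq_neg_le hp (spiroExponent_ne_zero hp)
    ((Nat.add_le_add_right (Nat.div_le_div_left hmil (by norm_num)) 1).trans hL)).trans ?_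
  have hp0 : (0 : ℝ) < p := by exact_mod_cast hp.pos
  have hlog := Real.log_le_two_mul_sqrt hp0
  have hsR : √(p : ℝ) ≤ √R := Real.sqrt_le_sqrt (by exact_mod_cast hR)
  have hs0 : 0 < √(p : ℝ) := Real.sqrt_pos.2 hp0
  have hs2 : √(p : ℝ) ^ 2 = p := Real.sq_sqrt hp0.le
  rw [spiroExponent, if_neg (by omega)]
  calc _ ≤ ((m : ℝ) / (p : ℝ) ^ 2 + 1) * (3 * (2 * √p)) := by
        push_cast
        gcongr
        norm_num
    _ = 6 * m * (1 / ((p : ℝ) * √p)) + 6 * √p := by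
        field_simp
        rw [hs2]
        ring
    _ ≤ _ := by linarith

lemma sum_log_primes_Ioo_ge {m L : ℕ} (hm : 10 ^ 10 < m) (hL : L = m / 10 ^ 6 + 1) :
    0.6 * (m : ℝ) ≤ ∑ q ∈ Finset.Ioo L m with q.Prime, Real.log q := by
  obtain ⟨n, rfl⟩ : ∃ n, m = n + 1 := ⟨m - 1, by omega⟩
  have hLn : L ≤ n := by omega
  have hsplit : Chebyshev.theta n =
      Chebyshev.theta L + ∑ q ∈ Finset.Ioo L (n + 1) with q.Prime, Real.log q := by
    have hI : Finset.Ioo L (n + 1) = Finset.Ioc L n := by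
      ext; simp
    simp only [Chebyshev.theta, Nat.floor_natCast, hI, Finset.sum_filter]
    exact (Finset.sum_Ioc_consecutive _ (Nat.zero_le L) hLn).symm
  have hlow := Chebyshev.theta_ge n
  have hup := Chebyshev.theta_le_log4_mul_x (x := L) (by positivity)
  have hlog4 : Real.log 4 ≤ 1.4 := by
    rw [show (4 : ℝ) = 2 ^ 2 by norm_num, Real.log_pow]
    push_cast
    linarith [Real.log_two_lt_d9]
  have hn : (10 : ℝ) ^ 10 ≤ n := by exact_mod_cast (by omega : 10 ^ 10 ≤ n)
  have hLle : (L : ℝ) ≤ ((n : ℝ) + 1) / 10 ^ 6 + 1 := by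
    rw [hL]
    push_cast
    gcongr
    exact_mod_cast Nat.cast_div_le (α := ℝ) (m := n + 1) (n := 10 ^ 6)
  have hn0 : (0 : ℝ) < n := by linarith
  set s := √(√(n : ℝ)) with hs
  have hs2 : s ^ 2 = √(n : ℝ) := Real.sq_sqrt (Real.sqrt_nonneg _)
  have hr2 : √(n : ℝ) ^ 2 = n := Real.sq_sqrt hn0.le
  have hs316 : 316 ≤ s := by
    refine Real.le_sqrt_of_sq_le (Real.le_sqrt_of_sq_le ?_)
    linarith
  have hlogn : Real.log n ≤ 4 * s := by
    have h := Real.log_le_two_mul_sqrt (Real.sqrt_pos.2 hn0)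
    rw [Real.log_sqrt hn0.le] at h
    linarith
  have hlogn1 : Real.log ((n : ℝ) + 1) ≤ 1 + 4 * s := by
    have h1 : Real.log ((n : ℝ) + 1) ≤ Real.log (2 * n) :=
      Real.log_le_log (by linarith) (by linarith)
    rw [Real.log_mul (by norm_num) hn0.ne'] at h1
    linarith [Real.log_two_lt_d9]
  have hs4 : (n : ℝ) = s ^ 4 := by rw [← hr2, ← hs2]; ring
  have hmain : 2 * √(n : ℝ) * Real.log n ≤ 0.03 * n := by
    rw [← hs2]
    have h1 : 2 * s ^ 2 * Real.log n ≤ 2 * s ^ 2 * (4 * s) := by gcongr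
    have h3 : 316 * s ^ 3 ≤ s * s ^ 3 := by gcongr
    have h5 : 0 ≤ s ^ 3 := by positivity
    rw [hs4] at h1 ⊢
    linarith [show s * s ^ 3 = s ^ 4 by ring, show 2 * s ^ 2 * (4 * s) = 8 * s ^ 3 by ring]
  have hsn : s ≤ 0.001 * n := by
    have h1 : 316 ^ 3 * s ≤ s ^ 3 * s := by gcongr
    have : s ^ 3 * s = n := by rw [hs4]; ring
    linarith
  have hup' : Chebyshev.theta L ≤ 1.4 * L := hup.trans (by gcongr)
  have hlow2 : 0.69 * (n : ℝ) ≤ n * Real.log 2 := by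
    rw [mul_comm]
    exact mul_le_mul_of_nonneg_left (by linarith [Real.log_two_gt_d9]) hn0.le
  push_cast
  linarith

lemma sum_Ioc_large_le {m R : ℕ} (hm : 10 ^ 10 < m) (hR : R = Nat.sqrt (2 * m)) :
    ∑ p ∈ Finset.Ioc 1000 R, (6 * m * (1 / ((p : ℝ) * √p)) + 6 * √R) ≤ 0.43 * (m : ℝ) := by
  have hRge : 141000 ≤ R := by
    rw [hR, Nat.le_sqrt]
    omega
  have hRsq : (R : ℝ) ^ 2 ≤ 2 * m := by
    have : R * R ≤ 2 * m := hR ▸ Nat.sqrt_le (2 * m)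
    rw [sq]
    exact_mod_cast this
  rw [Finset.sum_add_distrib, ← Finset.mul_sum, Finset.sum_const, Nat.card_Ioc, nsmul_eq_mul]
  have h1 := sum_Ioc_inv_mul_sqrt_le (by norm_num : 0 < 1000) (le_trans (by norm_num) hRge : 1000 ≤ R)
  have h2 : 2 / √((1000 : ℕ) : ℝ) ≤ 0.064 := by
    rw [div_le_iff₀ (Real.sqrt_pos.2 (by norm_num))]
    have : (31.6 : ℝ) ≤ √((1000 : ℕ) : ℝ) := Real.le_sqrt_of_sq_le (by norm_num)
    linarith
  have h3 : 0 ≤ 2 / √(R : ℝ) := by positivity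
  have hRr : (141000 : ℝ) ≤ R := by exact_mod_cast hRge
  have hs : 375 ≤ √(R : ℝ) := Real.le_sqrt_of_sq_le (by linarith)
  have hs2 : √(R : ℝ) ^ 2 = R := Real.sq_sqrt (by linarith)
  have h4 : ((R - 1000 : ℕ) : ℝ) * (6 * √R) ≤ R * (6 * √R) := by
    gcongr
    exact Nat.sub_le _ _
  have h5 : 375 * (R * √(R : ℝ)) ≤ R ^ 2 := by
    calc 375 * (R * √(R : ℝ)) ≤ √(R : ℝ) * (R * √(R : ℝ)) := by gcongr
      _ = R * √(R : ℝ) ^ 2 := by ring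
      _ = R ^ 2 := by rw [hs2]; ring
  have hm0 : (0 : ℝ) ≤ m := by positivity
  have h6 : 6 * (m : ℝ) * ∑ n ∈ Finset.Ioc 1000 R, 1 / ((n : ℝ) * √n) ≤ 6 * m * 0.064 := by
    gcongr
    linarith
  linarith

theorem stmt_9 (m : ℕ) (hm : 10 ^ 10 < m) :
    ∃ q : ℕ, q.Prime ∧ Odd q ∧ q ≤ m - 1 ∧ m + q ∈ SpiroH := by
  by_contra! hcon
  obtain ⟨L, hL⟩ : ∃ L, L = m / 10 ^ 6 + 1 := ⟨_, rfl⟩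
  obtain ⟨R, hR⟩ : ∃ R, R = Nat.sqrt (2 * m) := ⟨_, rfl⟩
  set B : ℕ → Finset ℕ := fun p =>
    {q ∈ Finset.Ioo L m | q.Prime ∧ p ^ spiroExponent p ∣ m + q} with hB
  set S := {p ∈ Finset.range 1000 | p.Prime} with hS
  set T := {p ∈ Finset.Ioc 1000 R | p.Prime} with hT
  have hcover : ∀ q ∈ {q ∈ Finset.Ioo L m | q.Prime}, ∃ p ∈ S ∪ T, q ∈ B p := by
    intro q hq
    simp only [Finset.mem_filter, Finset.mem_Ioo] at hq
    obtain ⟨⟨hLq, hqm⟩, hqp⟩ := hq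
    obtain ⟨p, hp, hdvd⟩ := exists_pow_spiroExponent_dvd (by omega)
      (hcon q hqp (hqp.odd_of_ne_two (by omega)) (by omega))
    refine ⟨p, ?_, by simp [hB, hLq, hqm, hqp, hdvd]⟩
    simp only [hS, hT, Finset.mem_union, Finset.mem_filter, Finset.mem_range, Finset.mem_Ioc]
    rcases lt_trichotomy p 1000 with h | h | h
    · exact Or.inl ⟨h, hp⟩
    · subst h
      norm_num at hp
    · refine Or.inr ⟨⟨h, ?_⟩, hp⟩
      rw [spiroExponent, if_neg (by omega)] at hdvd
      rw [hR, Nat.le_sqrt']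
      exact (Nat.le_of_dvd (by omega) hdvd).trans (by omega)
  have hunion : ∑ q ∈ Finset.Ioo L m with q.Prime, Real.log q ≤
      ∑ p ∈ S ∪ T, ∑ q ∈ B p, Real.log q := by
    calc ∑ q ∈ Finset.Ioo L m with q.Prime, Real.log q
        ≤ ∑ q ∈ Finset.Ioo L m with q.Prime,
            ∑ p ∈ S ∪ T, if q ∈ B p then Real.log q else 0 := by
          refine Finset.sum_le_sum fun q hq => ?_
          obtain ⟨p, hp, hqB⟩ := hcover q hq
          refine le_trans (by rw [if_pos hqB]) (Finset.single_le_sum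
            (f := fun p => if q ∈ B p then Real.log q else 0) (fun p _ => ?_) hp)
          split_ifs
          exacts [Real.log_natCast_nonneg q, le_rfl]
      _ = ∑ p ∈ S ∪ T, ∑ q ∈ Finset.Ioo L m with q.Prime,
            if q ∈ B p then Real.log q else 0 := Finset.sum_comm
      _ ≤ ∑ p ∈ S ∪ T, ∑ q ∈ B p, Real.log q := by
          refine Finset.sum_le_sum fun p _ => ?_
          rw [← Finset.sum_filter]
          exact Finset.sum_le_sum_of_subset_of_nonneg
            (fun q hq => (Finset.mem_filter.1 hq).2) fun q _ _ => Real.log_natCast_nonneg q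
  have hST : ∑ p ∈ S ∪ T, ∑ q ∈ B p, Real.log q ≤
      ∑ p ∈ S, ∑ q ∈ B p, Real.log q + ∑ p ∈ T, ∑ q ∈ B p, Real.log q := by
    rw [← Finset.sum_union_inter]
    exact le_add_of_nonneg_right
      (Finset.sum_nonneg fun _ _ => Finset.sum_nonneg fun q _ => Real.log_natCast_nonneg q)
  have hsmall : ∑ p ∈ S, ∑ q ∈ B p, Real.log q ≤ 1000 * (28 * ((m : ℝ) / 10 ^ 6 + 1)) := by
    calc ∑ p ∈ S, ∑ q ∈ B p, Real.log q ≤ ∑ p ∈ S, 28 * ((m : ℝ) / 10 ^ 6 + 1) :=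
          Finset.sum_le_sum fun p hp => by
            simp only [hS, Finset.mem_filter, Finset.mem_range] at hp
            exact sum_log_small_prime_le hp.2 hp.1 hL.ge
      _ ≤ ∑ p ∈ Finset.range 1000, 28 * ((m : ℝ) / 10 ^ 6 + 1) :=
          Finset.sum_le_sum_of_subset_of_nonneg (Finset.filter_subset _ _)
            fun _ _ _ => by positivity
      _ = _ := by simp
  have hlarge : ∑ p ∈ T, ∑ q ∈ B p, Real.log q ≤ 0.43 * (m : ℝ) := by
    calc ∑ p ∈ T, ∑ q ∈ B p, Real.log q
        ≤ ∑ p ∈ T, (6 * m * (1 / ((p : ℝ) * √p)) + 6 * √R) :=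
          Finset.sum_le_sum fun p hp => by
            simp only [hT, Finset.mem_filter, Finset.mem_Ioc] at hp
            exact sum_log_large_prime_le hp.2 hp.1.1 hp.1.2 hL.ge
      _ ≤ ∑ p ∈ Finset.Ioc 1000 R, (6 * m * (1 / ((p : ℝ) * √p)) + 6 * √R) :=
          Finset.sum_le_sum_of_subset_of_nonneg (Finset.filter_subset _ _)
            fun p _ _ => by
              clear * -
              positivity
      _ ≤ _ := sum_Ioc_large_le hm hR
  have hlow := sum_log_primes_Ioo_ge hm hL
  have hm' : (10 : ℝ) ^ 10 < m := by exact_mod_cast hm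
  linarith
end

section
/- Let H be the set of positive integers n such that for every prime p > 1000 the p-adic valuation v_p(n) is at most 1, and for every prime p < 1000 the p-adic valuation v_p(n) is at most ⌊9·log 10 / log p⌋ − 1. For a positive integer n define H_n = { mn : m ∈ H, gcd(m,n) = 1 } if n is even, and H_n = { 2mn : 2m ∈ H, gcd(m,n) = 1 } if n is odd. Then H_n has positive lower density: liminf_{x→∞} |H_n ∩ [1,x]| / x > 0. -/
open scoped Classical

/-- The set `H_n` built from the Spiro set. -/
def SpiroHn (n : ℕ) : Set ℕ :=
  if 2 ∣ n then {k | ∃ m ∈ SpiroH, Nat.Coprime m n ∧ k = m * n}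
  else {k | ∃ m : ℕ, 2 * m ∈ SpiroH ∧ Nat.Coprime m n ∧ k = 2 * m * n}

/-- The primes below `1000` are allowed an exponent of at least `2` in the Spiro set. -/
lemma two_le_floor_log_div_sub_one {p : ℕ} (hp : p.Prime) (h : p < 1000) :
    (2 : ℤ) ≤ ⌊(9 : ℝ) * Real.log 10 / Real.log p⌋ - 1 := by
  have h1 : (1 : ℝ) < p := by exact_mod_cast hp.one_lt
  have hlog : 0 < Real.log p := Real.log_pos h1
  have hle : Real.log p ≤ 3 * Real.log 10 := by
    have hpow : (3 : ℝ) * Real.log 10 = Real.log (10 ^ 3) := by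
      rw [Real.log_pow]; norm_num
    rw [hpow]
    refine Real.log_le_log (by linarith) ?_
    have : (p : ℝ) < 1000 := by exact_mod_cast h
    linarith
  have : (3 : ℤ) ≤ ⌊(9 : ℝ) * Real.log 10 / Real.log p⌋ := by
    rw [Int.le_floor, le_div_iff₀ hlog]
    push_cast
    linarith
  linarith

lemma Squarefree.mem_spiroH {m : ℕ} (hm : Squarefree m) : m ∈ SpiroH := by
  refine ⟨Nat.pos_of_ne_zero hm.ne_zero, fun p hp => ?_⟩
  have h1 : padicValNat p m ≤ 1 := by
    rw [← Nat.factorization_def m hp]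
    exact hm.natFactorization_le_one p
  refine ⟨fun _ => h1, fun h => ?_⟩
  have := two_le_floor_log_div_sub_one hp h
  have h1' : (padicValNat p m : ℤ) ≤ 1 := by exact_mod_cast h1
  linarith

/-- Among the first `J` terms of `1, 1 + Q, 1 + 2 * Q, …`, at most `J / r + 1` are divisible
by `r`. -/
lemma card_filter_dvd_one_add_mul_le (Q J : ℕ) {r : ℕ} (hr : 0 < r) :
    (((Finset.range J).filter (fun j => r ∣ 1 + Q * j)).card : ℝ) ≤ J * ((r : ℝ))⁻¹ + 1 := by
  rcases ((Finset.range J).filter (fun j => r ∣ 1 + Q * j)).eq_empty_or_nonempty with he | ⟨a, ha⟩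
  · rw [he]
    simp only [Finset.card_empty, Nat.cast_zero]
    positivity
  have had : r ∣ 1 + Q * a := (Finset.mem_filter.1 ha).2
  have hcop : Nat.gcd r Q = 1 := by
    have h1 : Nat.gcd r Q ∣ 1 + Q * a := (Nat.gcd_dvd_left r Q).trans had
    have h2 : Nat.gcd r Q ∣ Q * a := (Nat.gcd_dvd_right r Q).mul_right a
    exact Nat.dvd_one.1 ((Nat.dvd_add_left h2).1 h1)
  have hsub : (Finset.range J).filter (fun j => r ∣ 1 + Q * j) ⊆
      (Finset.range J).filter (fun j => j ≡ a [MOD r]) := by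
    intro j hj
    rw [Finset.mem_filter] at hj ⊢
    refine ⟨hj.1, ?_⟩
    have h : 1 + Q * j ≡ 1 + Q * a [MOD r] :=
      ((Nat.modEq_zero_iff_dvd).2 hj.2).trans ((Nat.modEq_zero_iff_dvd).2 had).symm
    exact Nat.ModEq.cancel_left_of_coprime hcop (Nat.ModEq.add_left_cancel' 1 h)
  have hcard : ((Finset.range J).filter (fun j => j ≡ a [MOD r])).card ≤ J / r + 1 := by
    rw [← Nat.count_eq_card_filter_range, Nat.count_modEq_card J hr]
    split_ifs <;> omega
  calc (((Finset.range J).filter (fun j => r ∣ 1 + Q * j)).card : ℝ)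
      ≤ ((J / r + 1 : ℕ) : ℝ) := by exact_mod_cast (Finset.card_le_card hsub).trans hcard
    _ ≤ J * ((r : ℝ))⁻¹ + 1 := by
      push_cast
      have := @Nat.cast_div_le ℝ _ _ _ J r
      rw [div_eq_mul_inv] at this
      linarith

/-- For even `Q`, at least a quarter of the terms of a sufficiently long initial piece of
`1, 1 + Q, 1 + 2 * Q, …` are squarefree. -/
lemma quarter_le_card_squarefree_one_add_mul {Q J : ℕ} (hQ : 2 ∣ Q) (hQ0 : 0 < Q)
    (hJ : 32 * Q ≤ J) :
    (J : ℝ) / 4 ≤ ((Finset.range J).filter (fun j => Squarefree (1 + Q * j))).card := by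
  set s := Nat.sqrt (1 + Q * J) with hs
  have hbad : (Finset.range J).filter (fun j => ¬ Squarefree (1 + Q * j)) ⊆
      (Finset.Ioc 2 s).biUnion
        (fun d => (Finset.range J).filter (fun j => d ^ 2 ∣ 1 + Q * j)) := by
    intro j hj
    rw [Finset.mem_filter, Finset.mem_range] at hj
    obtain ⟨hjJ, hj⟩ := hj
    rw [Nat.squarefree_iff_prime_squarefree] at hj
    push Not at hj
    obtain ⟨p, hp, hpd⟩ := hj
    simp only [Finset.mem_biUnion, Finset.mem_filter, Finset.mem_range, Finset.mem_Ioc]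
    refine ⟨p, ⟨lt_of_le_of_ne hp.two_le ?_, ?_⟩, hjJ, by rwa [sq]⟩
    · rintro rfl
      have h1 : 2 ∣ 1 + Q * j := (Dvd.intro _ rfl).trans hpd
      have h2 : 2 ∣ Q * j := hQ.mul_right j
      omega
    · rw [hs, Nat.le_sqrt]
      refine (Nat.le_of_dvd (by omega) hpd).trans ?_
      have := Nat.mul_le_mul_left Q hjJ.le
      omega
  have hbadcard : (((Finset.range J).filter (fun j => ¬ Squarefree (1 + Q * j))).card : ℝ) ≤
      J / 2 + s := by
    calc (((Finset.range J).filter (fun j => ¬ Squarefree (1 + Q * j))).card : ℝ)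
        ≤ ((∑ d ∈ Finset.Ioc 2 s,
            ((Finset.range J).filter (fun j => d ^ 2 ∣ 1 + Q * j)).card : ℕ) : ℝ) := by
          exact_mod_cast (Finset.card_le_card hbad).trans Finset.card_biUnion_le
      _ ≤ ∑ d ∈ Finset.Ioc 2 s, ((J : ℝ) * ((d : ℝ) ^ 2)⁻¹ + 1) := by
          push_cast
          refine Finset.sum_le_sum fun d hd => ?_
          have hd0 : 0 < d := by have := (Finset.mem_Ioc.1 hd).1; omega
          have := card_filter_dvd_one_add_mul_le Q J (pow_pos hd0 2)
          push_cast at this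
          exact this
      _ = J * (∑ d ∈ Finset.Ioc 2 s, ((d : ℝ) ^ 2)⁻¹) + ((s - 2 : ℕ) : ℝ) := by
          rw [Finset.sum_add_distrib, ← Finset.mul_sum]
          simp
      _ ≤ J * (1 / 2) + s := by
          have hsum : ∑ d ∈ Finset.Ioc 2 s, ((d : ℝ) ^ 2)⁻¹ ≤ 1 / 2 := by
            rcases le_total 2 s with h | h
            · have := sum_Ioc_inv_sq_le_sub (α := ℝ) two_ne_zero h
              have h0 : (0 : ℝ) ≤ (s : ℝ)⁻¹ := by positivity
              push_cast at this
              linarith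
            · rw [Finset.Ioc_eq_empty (by omega)]
              norm_num
          have hs2 : ((s - 2 : ℕ) : ℝ) ≤ s := by exact_mod_cast Nat.sub_le s 2
          gcongr
      _ = J / 2 + s := by ring
  have hs4 : (s : ℝ) ≤ J / 4 := by
    refine abs_le_of_sq_le_sq' ?_ (by positivity) |>.2
    have h1 : (s : ℝ) ^ 2 ≤ 1 + Q * J := by exact_mod_cast Nat.sqrt_le' (1 + Q * J)
    have h2 : (32 : ℝ) * Q ≤ J := by exact_mod_cast hJ
    have h3 : (1 : ℝ) ≤ Q := by exact_mod_cast hQ0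
    nlinarith
  have hsplit := Finset.card_filter_add_card_filter_not (s := Finset.range J)
    (fun j => Squarefree (1 + Q * j))
  rw [Finset.card_range] at hsplit
  have hsplit' : (((Finset.range J).filter (fun j => Squarefree (1 + Q * j))).card : ℝ) +
      ((Finset.range J).filter (fun j => ¬ Squarefree (1 + Q * j))).card = J := by
    exact_mod_cast hsplit
  linarith

/-- A set containing `c * m` for every squarefree `m ≡ 1 [MOD Q]`, with `Q` even, has positive
lower density. -/
lemma liminf_card_filter_div_pos_of_squarefree {A : Set ℕ} {c Q : ℕ} (hc : 0 < c) (hQ : 2 ∣ Q)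
    (hQ0 : 0 < Q) (hA : ∀ j, Squarefree (1 + Q * j) → c * (1 + Q * j) ∈ A) :
    0 < Filter.atTop.liminf (fun x : ℕ =>
      (((Finset.Icc 1 x).filter (fun k => k ∈ A)).card : ℝ) / x) := by
  have hcQ : 0 < c * Q := Nat.mul_pos hc hQ0
  have hcQ' : (0 : ℝ) < (c * Q : ℕ) := by exact_mod_cast hcQ
  refine lt_of_lt_of_le (b := 1 / (8 * ((c * Q : ℕ) : ℝ))) (by positivity) ?_
  refine Filter.le_liminf_of_le ?_ ?_
  · refine Filter.IsBoundedUnder.isCoboundedUnder_ge ⟨1, ?_⟩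
    rw [Filter.eventually_map]
    refine Filter.Eventually.of_forall fun x => div_le_one_of_le₀ ?_ (by positivity)
    have := Finset.card_filter_le (Finset.Icc 1 x) (fun k => k ∈ A)
    rw [Nat.card_Icc, Nat.add_sub_cancel] at this
    exact_mod_cast this
  · filter_upwards [Filter.eventually_ge_atTop (32 * Q * (c * Q))] with x hx
    set J := x / (c * Q) with hJ
    have hJ32 : 32 * Q ≤ J := (Nat.le_div_iff_mul_le hcQ).2 hx
    have hxpos : 0 < x := lt_of_lt_of_le (by positivity) hx
    have hinj : ((Finset.range J).filter (fun j => Squarefree (1 + Q * j))).card ≤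
        ((Finset.Icc 1 x).filter (fun k => k ∈ A)).card := by
      refine Finset.card_le_card_of_injOn (fun j => c * (1 + Q * j)) ?_ ?_
      · intro j hj
        simp only [Finset.coe_filter, Finset.mem_range, Set.mem_ofPred_eq] at hj
        simp only [Finset.coe_filter, Finset.mem_Icc, Set.mem_ofPred_eq]
        refine ⟨⟨Nat.mul_pos hc (by omega), ?_⟩, hA j hj.2⟩
        calc c * (1 + Q * j) ≤ c * (Q * (j + 1)) := by
              refine Nat.mul_le_mul_left c ?_
              rw [Nat.mul_add]
              omega
          _ ≤ c * (Q * J) := by gcongr; omega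
          _ = J * (c * Q) := by ring
          _ ≤ x := Nat.div_mul_le_self x (c * Q)
      · intro i _ j _ hij
        have h1 := Nat.eq_of_mul_eq_mul_left hc hij
        exact Nat.eq_of_mul_eq_mul_left hQ0 (Nat.add_left_cancel h1)
    have hquarter := quarter_le_card_squarefree_one_add_mul hQ hQ0 hJ32
    have hinj' : (((Finset.range J).filter (fun j => Squarefree (1 + Q * j))).card : ℝ) ≤
        ((Finset.Icc 1 x).filter (fun k => k ∈ A)).card := by exact_mod_cast hinj
    have hxJ : (x : ℝ) ≤ 2 * J * (c * Q : ℕ) := by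
      have h1 : x < (c * Q) * (J + 1) := Nat.lt_mul_div_succ x hcQ
      have h2 : (c * Q) * (J + 1) ≤ (c * Q) * (2 * J) := Nat.mul_le_mul_left _ (by omega)
      have h3 : x ≤ 2 * J * (c * Q) := by linarith
      exact_mod_cast h3
    rw [le_div_iff₀ (by exact_mod_cast hxpos), one_div_mul_eq_div, div_le_iff₀ (by positivity)]
    nlinarith

theorem stmt_11 (n : ℕ) (hn : 0 < n) :
    0 < Filter.atTop.liminf (fun x : ℕ =>
      (((Finset.Icc 1 x).filter (fun k => k ∈ SpiroHn n)).card : ℝ) / x) := by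
  have hcop : ∀ j, Nat.Coprime (1 + 2 * n * j) (2 * n) := fun j => by simp
  by_cases h : 2 ∣ n
  · refine liminf_card_filter_div_pos_of_squarefree (c := n) (Q := 2 * n) hn
      (Dvd.intro _ rfl) (by omega) fun j hj => ?_
    rw [SpiroHn, if_pos h]
    exact ⟨_, hj.mem_spiroH, (hcop j).coprime_mul_left_right, Nat.mul_comm _ _⟩
  · refine liminf_card_filter_div_pos_of_squarefree (c := 2 * n) (Q := 2 * n) (by omega)
      (Dvd.intro _ rfl) (by omega) fun j hj => ?_
    rw [SpiroHn, if_neg h]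
    refine ⟨1 + 2 * n * j, ?_, (hcop j).coprime_mul_left_right, by ring⟩
    refine Squarefree.mem_spiroH ?_
    exact (Nat.squarefree_mul (hcop j).coprime_mul_right_right.symm).2
      ⟨Nat.prime_two.squarefree, hj⟩
end
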